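/- arXiv:1707.05440 — 2 statements merged into one kernel-verified Lean document; each statement's English description precedes it below -/
import Mathlib

section
/- Every set S of n ≥ 4 points in the plane in general position admits at least 2 pairwise edge-disjoint plane spanning paths. -/
/-- Points in the plane. -/
abbrev Pt : Type := ℝ × ℝ

/-- A finite point set is in general position if no three of its points are collinear. -/
def GenPos (S : Finset Pt) : Prop :=
  ∀ p ∈ S, ∀ q ∈ S, ∀ r ∈ S, p ≠ q → p ≠ r → q ≠ r →
    ¬ Collinear ℝ ({p, q, r} : Set Pt)

/-- A geometric graph on `S` (a simple graph on the points of `S`, edges drawn as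
straight segments) is plane if the open segments of any two distinct edges are disjoint. -/
def IsPlaneGraph {S : Finset Pt} (G : SimpleGraph {x // x ∈ S}) : Prop :=
  ∀ a b c d : {x // x ∈ S}, G.Adj a b → G.Adj c d → s(a, b) ≠ s(c, d) →
    openSegment ℝ (a : Pt) (b : Pt) ∩ openSegment ℝ (c : Pt) (d : Pt) = ∅

/-- A plane spanning tree of `S`: a tree on all points of `S` drawn without crossings. -/
def IsPlaneSpanningTree {S : Finset Pt} (G : SimpleGraph {x // x ∈ S}) : Prop :=
  G.IsTree ∧ IsPlaneGraph G

/-- A plane spanning path of `S`: a plane spanning tree in which every vertex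
has degree at most two (i.e. a plane Hamiltonian path). -/
def IsPlaneSpanningPath {S : Finset Pt} (G : SimpleGraph {x // x ∈ S}) : Prop :=
  IsPlaneSpanningTree G ∧
    ∀ v a b c : {x // x ∈ S}, G.Adj v a → G.Adj v b → G.Adj v c →
      (a = b ∨ a = c ∨ b = c)

/-- The open segment spanned by an unordered pair of points. -/
def segOpen (e : Sym2 Pt) : Set Pt :=
  Sym2.lift ⟨fun a b => openSegment ℝ a b, fun a b => openSegment_symm ℝ a b⟩ e

/-- `F` is a crossing family in `S`: a set of nondegenerate segments with endpoints
in `S`, any two of which cross (their open segments intersect). -/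
def IsCrossingFamily (S : Finset Pt) (F : Finset (Sym2 Pt)) : Prop :=
  (∀ e ∈ F, ¬ e.IsDiag ∧ ∀ x ∈ e, x ∈ S) ∧
  (∀ e ∈ F, ∀ f ∈ F, e ≠ f → (segOpen e ∩ segOpen f).Nonempty)

/-- `x` lies strictly to the left of the directed line from `p` to `q`. -/
def leftOf (p q x : Pt) : Prop :=
  0 < (q.1 - p.1) * (x.2 - p.2) - (q.2 - p.2) * (x.1 - p.1)

/-- `x` lies strictly to the right of the directed line from `p` to `q`. -/
def rightOf (p q x : Pt) : Prop :=
  (q.1 - p.1) * (x.2 - p.2) - (q.2 - p.2) * (x.1 - p.1) < 0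

/-- The double star on `S` associated with the directed edge `pq`: the edge `pq`,
the edges from `p` to all points strictly left of the directed line `pq`, and the
edges from `q` to all points strictly right of it. -/
def doubleStar (S : Finset Pt) (p q : Pt) : SimpleGraph {x // x ∈ S} :=
  SimpleGraph.fromRel fun a b =>
    ((a : Pt) = p ∧ (b : Pt) = q) ∨
    ((a : Pt) = p ∧ leftOf p q (b : Pt)) ∨
    ((a : Pt) = q ∧ rightOf p q (b : Pt))

/-- The regular wheel configuration `W_{2n}`: `2n-1` points regularly spaced on the
unit circle together with its center. -/
noncomputable def wheel (n : ℕ) : Finset Pt :=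
  insert ((0 : ℝ), (0 : ℝ)) <| (Finset.range (2 * n - 1)).image fun j : ℕ =>
    (Real.cos (2 * Real.pi * (j : ℝ) / ((2 * n - 1 : ℕ) : ℝ)),
     Real.sin (2 * Real.pi * (j : ℝ) / ((2 * n - 1 : ℕ) : ℝ)))

def oo (p q r : Pt) : ℝ := (q.1 - p.1) * (r.2 - p.2) - (q.2 - p.2) * (r.1 - p.1)

def NC (a b c d : Pt) : Prop := openSegment ℝ a b ∩ openSegment ℝ c d = ∅

lemma oo_cyc (p q r : Pt) : oo p q r = oo q r p := by unfold oo; ring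
lemma oo_swap (p q r : Pt) : oo p q r = - oo q p r := by unfold oo; ring
lemma oo_swap' (p q r : Pt) : oo p q r = - oo p r q := by unfold oo; ring
@[simp] lemma oo_left (p q : Pt) : oo p q p = 0 := by unfold oo; ring
@[simp] lemma oo_right (p q : Pt) : oo p q q = 0 := by unfold oo; ring

lemma oo_comb (p q a b : Pt) (u v : ℝ) (h : u + v = 1) :
    oo p q (u • a + v • b) = u * oo p q a + v * oo p q b := by
  have : v = 1 - u := by linarith
  subst this
  simp only [oo, Prod.fst_add, Prod.snd_add, Prod.smul_fst, Prod.smul_snd, smul_eq_mul]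
  ring

/-- Separation by a line. -/
lemma sep (p q : Pt) (s : ℝ) {a b c d : Pt} (ha : s * oo p q a ≤ 0) (hb : s * oo p q b ≤ 0)
    (hc : 0 ≤ s * oo p q c) (hd : 0 ≤ s * oo p q d)
    (h : s * oo p q a < 0 ∨ s * oo p q b < 0 ∨ 0 < s * oo p q c ∨ 0 < s * oo p q d) :
    NC a b c d := by
  unfold NC
  rw [Set.eq_empty_iff_forall_notMem]
  rintro x ⟨⟨u, v, hu, hv, huv, rfl⟩, ⟨u', v', hu', hv', huv', hx⟩⟩
  have h1 := oo_comb p q a b u v huv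
  have h2 := oo_comb p q c d u' v' huv'
  rw [hx, h1] at h2
  have h3 : u * (s * oo p q a) + v * (s * oo p q b)
      = u' * (s * oo p q c) + v' * (s * oo p q d) := by
    linear_combination s * h2
  have e1 : u * (s * oo p q a) ≤ 0 := mul_nonpos_of_nonneg_of_nonpos hu.le ha
  have e2 : v * (s * oo p q b) ≤ 0 := mul_nonpos_of_nonneg_of_nonpos hv.le hb
  have e3 : 0 ≤ u' * (s * oo p q c) := mul_nonneg hu'.le hc
  have e4 : 0 ≤ v' * (s * oo p q d) := mul_nonneg hv'.le hd
  rcases h with h | h | h | h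
  · have := mul_neg_of_pos_of_neg hu h; linarith
  · have := mul_neg_of_pos_of_neg hv h; linarith
  · have := mul_pos hu' h; linarith
  · have := mul_pos hv' h; linarith

/-- Edge relation of a list seen as a path. -/
def Ed : List Pt → Pt → Pt → Prop
  | a :: b :: l, x, y => (x = a ∧ y = b) ∨ (x = b ∧ y = a) ∨ Ed (b :: l) x y
  | _, _, _ => False

@[simp] lemma Ed_nil (x y : Pt) : Ed [] x y ↔ False := by simp [Ed]
@[simp] lemma Ed_single (a x y : Pt) : Ed [a] x y ↔ False := by simp [Ed]
lemma Ed_cons (a b : Pt) (l : List Pt) (x y : Pt) :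
    Ed (a :: b :: l) x y ↔ (x = a ∧ y = b) ∨ (x = b ∧ y = a) ∨ Ed (b :: l) x y := by simp [Ed]

lemma Ed_mem : ∀ (l : List Pt) (x y : Pt), Ed l x y → x ∈ l ∧ y ∈ l
  | [], x, y, h => by simp at h
  | [a], x, y, h => by simp at h
  | a :: b :: l, x, y, h => by
    rw [Ed_cons] at h
    rcases h with ⟨rfl, rfl⟩ | ⟨rfl, rfl⟩ | h
    · simp
    · simp
    · have := Ed_mem (b :: l) x y h
      exact ⟨List.mem_cons_of_mem _ this.1, List.mem_cons_of_mem _ this.2⟩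

lemma Ed_symm : ∀ (l : List Pt) (x y : Pt), Ed l x y → Ed l y x
  | [], x, y, h => by simp at h
  | [a], x, y, h => by simp at h
  | a :: b :: l, x, y, h => by
    rw [Ed_cons] at h ⊢
    rcases h with h | h | h
    · exact Or.inr (Or.inl ⟨h.2, h.1⟩)
    · exact Or.inl ⟨h.2, h.1⟩
    · exact Or.inr (Or.inr (Ed_symm _ _ _ h))

lemma Ed_ne : ∀ (l : List Pt) (x y : Pt), l.Nodup → Ed l x y → x ≠ y
  | [], x, y, _, h => by simp at h
  | [a], x, y, _, h => by simp at h
  | a :: b :: l, x, y, hn, h => by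
    rw [Ed_cons] at h
    have hab : a ≠ b := by
      rintro rfl; simp at hn
    rcases h with ⟨rfl, rfl⟩ | ⟨rfl, rfl⟩ | h
    · exact hab
    · exact hab.symm
    · exact Ed_ne _ _ _ (List.nodup_cons.1 hn).2 h

def PlaneL (l : List Pt) : Prop :=
  ∀ a b c d, Ed l a b → Ed l c d → s(a, b) ≠ s(c, d) → NC a b c d

lemma NC_symm {a b c d : Pt} (h : NC a b c d) : NC c d a b := by
  unfold NC at *; rw [Set.inter_comm]; exact h
lemma NC_flip {a b c d : Pt} (h : NC a b c d) : NC b a c d := by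
  unfold NC at *; rw [openSegment_symm]; exact h
lemma NC_flip' {a b c d : Pt} (h : NC a b c d) : NC a b d c := by
  unfold NC at *; rw [openSegment_symm ℝ d c]; exact h

lemma plane_single (a : Pt) : PlaneL [a] := by
  intro a b c d h; simp at h

lemma plane_cons {a b : Pt} {l : List Pt} (h : PlaneL (b :: l))
    (h2 : ∀ c d, Ed (b :: l) c d → NC a b c d) : PlaneL (a :: b :: l) := by
  intro x y c d h3 h4 h5
  rw [Ed_cons] at h3 h4
  rcases h3 with ⟨rfl, rfl⟩ | ⟨rfl, rfl⟩ | h3 <;>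
    rcases h4 with ⟨rfl, rfl⟩ | ⟨rfl, rfl⟩ | h4
  · exact absurd rfl h5
  · exact absurd Sym2.eq_swap h5
  · exact h2 _ _ h4
  · exact absurd Sym2.eq_swap h5
  · exact absurd rfl h5
  · exact NC_flip (h2 _ _ h4)
  · exact NC_symm (h2 _ _ h3)
  · exact NC_symm (NC_flip (h2 _ _ h3))
  · exact h _ _ _ _ h3 h4 h5

lemma Ed_head {b c d : Pt} {l : List Pt} (hb : b ∉ l) (h : Ed (b :: l) c d) : c ≠ b ∨ d ≠ b := by
  cases l with
  | nil => simp at h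
  | cons e l =>
    rw [Ed_cons] at h
    have heb : e ≠ b := fun h => hb (h ▸ List.mem_cons_self)
    rcases h with ⟨rfl, rfl⟩ | ⟨rfl, rfl⟩ | h
    · exact Or.inr heb
    · exact Or.inl heb
    · left
      rintro rfl
      exact hb (Ed_mem _ _ _ h).1

lemma av1 (p q : Pt) (s : ℝ) {a b : Pt} {l : List Pt}
    (ha : s * oo p q a ≤ 0) (hb : s * oo p q b = 0) (hl : ∀ w ∈ l, 0 < s * oo p q w) :
    ∀ c d, Ed (b :: l) c d → NC a b c d := by
  intro c d h
  have hm := Ed_mem _ _ _ h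
  have key : ∀ w ∈ b :: l, 0 ≤ s * oo p q w ∧ (w ≠ b → 0 < s * oo p q w) := by
    intro w hw
    rcases List.mem_cons.1 hw with rfl | hw
    · exact ⟨hb.ge, fun h => absurd rfl h⟩
    · exact ⟨(hl w hw).le, fun _ => hl w hw⟩
  refine sep p q s ha hb.le (key c hm.1).1 (key d hm.2).1 ?_
  have hbl : b ∉ l := fun h => by
    have := hl b h
    linarith
  rcases Ed_head hbl h with hc | hd
  · right; right; left
    exact (key c hm.1).2 hc
  · right; right; right
    exact (key d hm.2).2 hd

lemma av2 (p q : Pt) (s : ℝ) {a b : Pt} {l : List Pt}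
    (ha : s * oo p q a < 0) (hb : s * oo p q b = 0) (hl : ∀ w ∈ l, 0 ≤ s * oo p q w) :
    ∀ c d, Ed (b :: l) c d → NC a b c d := by
  intro c d h
  have hm := Ed_mem _ _ _ h
  have key : ∀ w ∈ b :: l, 0 ≤ s * oo p q w := by
    intro w hw
    rcases List.mem_cons.1 hw with rfl | hw
    · exact hb.ge
    · exact hl w hw
  exact sep p q s ha.le hb.le (key c hm.1) (key d hm.2) (Or.inl ha)

def GPs (X : Finset Pt) : Prop :=
  ∀ p ∈ X, ∀ q ∈ X, ∀ r ∈ X, p ≠ q → p ≠ r → q ≠ r → oo p q r ≠ 0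

lemma GPs.mono {X Y : Finset Pt} (h : GPs X) (hs : Y ⊆ X) : GPs Y :=
  fun p hp q hq r hr => h p (hs hp) q (hs hq) r (hs hr)

lemma gps_of_genPos {S : Finset Pt} (h : GenPos S) : GPs S := by
  intro p hp q hq r hr hpq hpr hqr h0
  apply h p hp q hq r hr hpq hpr hqr
  rw [collinear_iff_of_mem (p₀ := p) (by simp)]
  refine ⟨q - p, ?_⟩
  intro x hx
  simp only [Set.mem_insert_iff, Set.mem_singleton_iff] at hx
  rcases hx with rfl | rfl | rfl
  · exact ⟨0, by simp⟩
  · exact ⟨1, by simp⟩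
  · unfold oo at h0
    by_cases h1 : q.1 - p.1 = 0
    · have h2 : q.2 - p.2 ≠ 0 := by
        intro h2
        exact hpq (Prod.ext (by linarith) (by linarith))
      have h3 : x.1 - p.1 = 0 := by
        rw [h1] at h0
        have : (q.2 - p.2) * (x.1 - p.1) = 0 := by linarith
        exact (mul_eq_zero.1 this).resolve_left h2
      refine ⟨(x.2 - p.2) / (q.2 - p.2), Prod.ext ?_ ?_⟩
      · simp [h1]; linarith
      · simp; field_simp; ring
    · refine ⟨(x.1 - p.1) / (q.1 - p.1), Prod.ext ?_ ?_⟩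
      · simp; field_simp; ring
      · simp; field_simp; linarith

/-- Plücker relation for four vectors at `v`. -/
lemma plk (v a b c d : Pt) :
    oo v a b * oo v c d - oo v a c * oo v b d + oo v a d * oo v b c = 0 := by
  unfold oo; ring

/-- Extreme element for a transitive total relation on a finset. -/
lemma ext_of_trans (R : Pt → Pt → Prop) (Y : Finset Pt) (hY : Y.Nonempty)
    (tot : ∀ a ∈ Y, ∀ b ∈ Y, a ≠ b → R a b ∨ R b a)
    (tr : ∀ a ∈ Y, ∀ b ∈ Y, ∀ c ∈ Y, R a b → R b c → R a c) :
    ∃ z ∈ Y, ∀ w ∈ Y, w ≠ z → R z w := by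
  induction hY using Finset.Nonempty.cons_induction with
  | singleton a => exact ⟨a, by simp, by simp⟩
  | cons a s ha hs ih =>
    obtain ⟨z, hz, hz2⟩ := ih
      (fun x hx y hy => tot x (Finset.mem_cons_of_mem hx) y (Finset.mem_cons_of_mem hy))
      (fun x hx y hy w hw => tr x (Finset.mem_cons_of_mem hx) y (Finset.mem_cons_of_mem hy)
        w (Finset.mem_cons_of_mem hw))
    have hza : z ≠ a := fun h => ha (h ▸ hz)
    rcases tot z (Finset.mem_cons_of_mem hz) a (Finset.mem_cons_self a s) hza with h | h
    · refine ⟨z, Finset.mem_cons_of_mem hz, fun w hw hwz => ?_⟩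
      rcases Finset.mem_cons.1 hw with rfl | hw
      · exact h
      · exact hz2 w hw hwz
    · refine ⟨a, Finset.mem_cons_self a s, fun w hw hwa => ?_⟩
      rcases Finset.mem_cons.1 hw with rfl | hw
      · exact absurd rfl hwa
      · by_cases hwz : w = z
        · rw [hwz]; exact h
        · exact tr a (Finset.mem_cons_self a s) z (Finset.mem_cons_of_mem hz) w
            (Finset.mem_cons_of_mem hw) h (hz2 w hw hwz)

/-- Extreme point in angular order around `v`, in a half-plane bounded by the line `r v`. -/
lemma ext_ang (v r : Pt) (s t : ℝ) (ht : t ≠ 0) (Y : Finset Pt) (hY : Y.Nonempty)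
    (hv : v ∉ Y) {X : Finset Pt} (gp : GPs X) (hvX : v ∈ X) (hYX : Y ⊆ X)
    (hs : ∀ w ∈ Y, 0 < s * oo r v w) :
    ∃ z ∈ Y, ∀ w ∈ Y, w ≠ z → 0 < t * oo v z w := by
  apply ext_of_trans (fun z w => 0 < t * oo v z w) Y hY
  · intro a ha b hb hab
    have h0 : oo v a b ≠ 0 := gp v hvX a (hYX ha) b (hYX hb)
      (fun h => hv (h ▸ ha)) (fun h => hv (h ▸ hb)) hab
    have h1 : t * oo v a b ≠ 0 := mul_ne_zero ht h0
    rcases lt_or_gt_of_ne h1 with h | h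
    · right
      rw [oo_swap' v b a]; linarith
    · left; exact h
  · intro a ha z hz w hw h1 h2
    have ca := hs a ha
    have cz := hs z hz
    have cw := hs w hw
    have e := plk v r a z w
    have q : ∀ x, oo r v x = - oo v r x := fun x => oo_swap r v x
    rw [q] at ca cz cw
    have e2 : (t * oo v a w) * (s * - oo v r z)
        = (t * oo v a z) * (s * - oo v r w) + (t * oo v z w) * (s * - oo v r a) := by
      linear_combination (s * t) * e
    have e3 : 0 < (t * oo v a w) * (s * - oo v r z) := by
      rw [e2]; exact add_pos (mul_pos h1 cw) (mul_pos h2 ca)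
    exact pos_of_mul_pos_left e3 cz.le

/-- If some point is left of `a v`, so is the leftmost one. -/
lemma left_of_left (v a r z w : Pt) (h1 : 0 < oo a v w) (h2 : oo v z w < 0)
    (h3 : 0 < oo r v z) (h4 : 0 < oo r v w) (h5 : oo r v a < 0) : 0 < oo a v z := by
  by_contra h
  push Not at h
  have e := plk v z w a r
  have q1 : oo a v w = oo v w a := oo_cyc _ _ _
  have q2 : oo a v z = oo v z a := oo_cyc _ _ _
  have q3 : oo r v z = oo v z r := oo_cyc _ _ _
  have q4 : oo r v w = oo v w r := oo_cyc _ _ _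
  have q5 : oo r v a = oo v a r := oo_cyc _ _ _
  rw [q1] at h1; rw [q2] at h; rw [q3] at h3; rw [q4] at h4; rw [q5] at h5
  have := mul_pos_of_neg_of_neg h2 h5
  have := mul_pos h3 h1
  have := mul_nonpos_of_nonpos_of_nonneg h h4.le
  linarith

def Good (X : Finset Pt) (x x' : Pt) (l l' : List Pt) : Prop :=
  (x :: l).Nodup ∧ (x' :: l').Nodup ∧ (∀ w, w ∈ x :: l ↔ w ∈ X) ∧ (∀ w, w ∈ x' :: l' ↔ w ∈ X) ∧
  PlaneL (x :: l) ∧ PlaneL (x' :: l') ∧ (∀ c d, Ed (x :: l) c d → ¬ Ed (x' :: l') c d)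

lemma Good.symm {X : Finset Pt} {x x' : Pt} {l l' : List Pt} (h : Good X x x' l l') :
    Good X x' x l' l := by
  obtain ⟨h1, h2, h3, h4, h5, h6, h7⟩ := h
  exact ⟨h2, h1, h4, h3, h6, h5, fun c d h h' => h7 c d h' h⟩

def IHm (m : ℕ) : Prop :=
  ∀ W : Finset Pt, W.card < m → 4 ≤ W.card → W.card % 4 ≠ 3 → GPs W →
    ∀ y ∈ W, ∀ y' ∈ W, y ≠ y' → (∀ w ∈ W, w ≠ y → w ≠ y' → 0 < oo y y' w) →
    ∃ l l', Good W y y' l l'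

lemma Next (m : ℕ) (ih : IHm m) (Y : Finset Pt) (ν z : Pt) (gp : GPs Y)
    (hz : z ∈ Y) (t : ℝ) (ht : t = 1 ∨ t = -1)
    (h : ∀ w ∈ Y, w ≠ z → 0 < t * oo ν z w)
    (hc : Y.card = 1 ∨ (4 ≤ Y.card ∧ Y.card % 4 ≠ 3 ∧ Y.card < m)) :
    ∃ z' l l', Good Y z z' l l' ∧ (∀ c d, Ed (z' :: l') c d → NC ν z' c d) ∧
      (1 < Y.card → z' ≠ z) := by
  rcases hc with hc | ⟨hc1, hc2, hc3⟩
  · obtain ⟨a, rfl⟩ := Finset.card_eq_one.1 hc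
    have : z = a := by simpa using hz
    subst this
    refine ⟨z, [], [], ⟨by simp, by simp, by simp, by simp, plane_single _, plane_single _,
      by simp⟩, by simp, by simp⟩
  · have hne : (Y.erase z).Nonempty := by
      rw [← Finset.card_pos, Finset.card_erase_of_mem hz]; omega
    have ht0 : -t ≠ 0 := by rcases ht with rfl | rfl <;> norm_num
    obtain ⟨z', hz', hz2⟩ := ext_ang z ν t (-t) ht0 (Y.erase z) hne (by simp) gp hz
      (Finset.erase_subset _ _) (fun w hw => h w (Finset.mem_of_mem_erase hw)
        (Finset.ne_of_mem_erase hw))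
    obtain ⟨hzz, hz'Y⟩ := Finset.mem_erase.1 hz'
    have hz3 : ∀ w ∈ Y, w ≠ z → w ≠ z' → 0 < -t * oo z z' w := fun w hw h1 h2 =>
      hz2 w (Finset.mem_erase.2 ⟨h1, hw⟩) h2
    have hG : ∃ l l', Good Y z z' l l' := by
      rcases ht with rfl | rfl
      · have := ih Y hc3 hc1 hc2 gp z' hz'Y z hz hzz (by
          intro w hw h1 h2
          have := hz3 w hw h2 h1
          rw [oo_swap] at this; linarith)
        obtain ⟨l, l', hl⟩ := this
        exact ⟨l', l, hl.symm⟩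
      · exact ih Y hc3 hc1 hc2 gp z hz z' hz'Y hzz.symm (by
          intro w hw h1 h2
          have := hz3 w hw h1 h2
          linarith)
    obtain ⟨l, l', hG⟩ := hG
    refine ⟨z', l, l', hG, ?_, fun _ => hzz⟩
    have h1 : 0 < t * oo ν z z' := h z' hz'Y hzz
    refine av2 z z' (-t) (by rw [← oo_cyc]; linarith) (by simp) ?_
    intro w hw
    have hwY : w ∈ Y := (hG.2.2.2.1 w).1 (List.mem_cons_of_mem _ hw)
    have hwz' : w ≠ z' := by
      rintro rfl; exact (List.nodup_cons.1 hG.2.1).1 hw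
    by_cases hwz : w = z
    · rw [hwz]; simp
    · exact (hz3 w hwY hwz hwz').le

lemma assemble {W Y : Finset Pt} {y y' μ ν z z' : Pt} {l l' : List Pt}
    (hW : ∀ w, w ∈ W ↔ w = y ∨ w = y' ∨ w = μ ∨ w = ν ∨ w ∈ Y)
    (hG : Good Y z z' l l') (h1 : y ≠ y') (h2 : y ≠ μ) (h3 : y ≠ ν) (h4 : y' ≠ μ)
    (h5 : y' ≠ ν) (h6 : μ ≠ ν) (g1 : y ∉ Y) (g2 : y' ∉ Y) (g3 : μ ∉ Y) (g4 : ν ∉ Y)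
    (p1 : PlaneL (y :: y' :: ν :: μ :: z :: l)) (p2 : PlaneL (y' :: μ :: y :: ν :: z' :: l')) :
    Good W y y' (y' :: ν :: μ :: z :: l) (μ :: y :: ν :: z' :: l') := by
  obtain ⟨a1, a2, a3, a4, a5, a6, a7⟩ := hG
  have zY : z ∈ Y := (a3 z).1 (by simp)
  have zY' : z' ∈ Y := (a4 z').1 (by simp)
  refine ⟨?_, ?_, ?_, ?_, p1, p2, ?_⟩
  · rw [List.nodup_cons, List.nodup_cons, List.nodup_cons, List.nodup_cons]
    simp only [List.mem_cons (b := y'), List.mem_cons (b := ν), List.mem_cons (b := μ), a3]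
    grind
  · rw [List.nodup_cons, List.nodup_cons, List.nodup_cons, List.nodup_cons]
    simp only [List.mem_cons (b := y), List.mem_cons (b := ν), List.mem_cons (b := μ), a4]
    grind
  · intro w
    rw [hW, List.mem_cons, List.mem_cons, List.mem_cons, List.mem_cons, a3]
    tauto
  · intro w
    rw [hW, List.mem_cons, List.mem_cons, List.mem_cons, List.mem_cons, a4]
    tauto
  · intro c d hcd hcd'
    have e1 : Ed (z :: l) c d → c ∈ Y ∧ d ∈ Y := fun h =>
      ⟨(a3 c).1 (Ed_mem _ _ _ h).1, (a3 d).1 (Ed_mem _ _ _ h).2⟩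
    have e2 : Ed (z' :: l') c d → c ∈ Y ∧ d ∈ Y := fun h =>
      ⟨(a4 c).1 (Ed_mem _ _ _ h).1, (a4 d).1 (Ed_mem _ _ _ h).2⟩
    have e3 := a7 c d
    rw [Ed_cons, Ed_cons, Ed_cons, Ed_cons] at hcd hcd'
    generalize Ed (z :: l) c d = A at *
    generalize Ed (z' :: l') c d = B at *
    clear hW a1 a2 a3 a4 a5 a6 a7 p1 p2
    rcases hcd with h | h | h | h | h | h | h | h | h <;>
      rcases hcd' with h' | h' | h' | h' | h' | h' | h' | h' | h' <;> grind

lemma caseA1 {Y : Finset Pt} {y y' μ ν z z' : Pt} {l l' : List Pt}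
    (hG : Good Y z z' l l') (hN : ∀ c d, Ed (z' :: l') c d → NC ν z' c d)
    (a1 : ∀ w ∈ Y, 0 < oo y y' w) (a2 : 0 < oo y y' μ) (a3 : 0 < oo y y' ν)
    (b1 : ∀ w ∈ Y, 0 < oo y μ w) (b2 : 0 < oo y μ ν)
    (c1 : ∀ w ∈ Y, oo μ ν w < 0) (c2 : 0 < oo y' μ ν)
    (d1 : ∀ w ∈ Y, w ≠ z → 0 < oo ν z w) :
    PlaneL (y :: y' :: ν :: μ :: z :: l) ∧ PlaneL (y' :: μ :: y :: ν :: z' :: l') := by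
  obtain ⟨g1, g2, g3, g4, g5, g6, g7⟩ := hG
  have zY : z ∈ Y := (g3 z).1 (by simp)
  have hl : ∀ w ∈ l, w ∈ Y ∧ w ≠ z := fun w hw => ⟨(g3 w).1 (by simp [hw]), by
    rintro rfl; exact (List.nodup_cons.1 g1).1 hw⟩
  constructor
  · refine plane_cons (plane_cons (plane_cons (plane_cons g5 ?_) ?_) ?_) ?_
    · refine av2 ν z 1 ?_ (by simp) ?_
      · have := c1 z zY; rw [oo_cyc] at this; linarith
      · intro w hw; have := d1 w (hl w hw).1 (hl w hw).2; linarith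
    · refine av1 μ ν (-1) (by simp) (by simp) ?_
      intro w hw; have := c1 w ((g3 w).1 hw); linarith
    · refine av2 μ ν (-1) ?_ (by simp) ?_
      · rw [← oo_cyc]; linarith
      · rw [List.forall_mem_cons]
        refine ⟨by simp, ?_⟩
        intro w hw; have := c1 w ((g3 w).1 hw); linarith
    · refine av1 y y' 1 (by simp) (by simp) ?_
      rw [List.forall_mem_cons, List.forall_mem_cons]
      refine ⟨by linarith, by linarith, ?_⟩
      intro w hw; have := a1 w ((g3 w).1 hw); linarith
  · refine plane_cons (plane_cons (plane_cons (plane_cons g6 hN) ?_) ?_) ?_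
    · refine av2 μ ν (-1) ?_ (by simp) ?_
      · rw [← oo_cyc]; linarith
      · intro w hw; have := c1 w ((g4 w).1 hw); linarith
    · refine av1 y μ 1 (by simp) (by simp) ?_
      rw [List.forall_mem_cons]
      refine ⟨by linarith, ?_⟩
      intro w hw; have := b1 w ((g4 w).1 hw); linarith
    · refine av2 y μ 1 ?_ (by simp) ?_
      · rw [oo_swap']; linarith
      · rw [List.forall_mem_cons, List.forall_mem_cons]
        refine ⟨by simp, by linarith, ?_⟩
        intro w hw; have := b1 w ((g4 w).1 hw); linarith

lemma caseA2 {Y : Finset Pt} {y y' μ ν z z' : Pt} {l l' : List Pt}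
    (hG : Good Y z z' l l') (hN : ∀ c d, Ed (z' :: l') c d → NC ν z' c d)
    (a1 : ∀ w ∈ Y, 0 < oo y y' w) (a2 : 0 < oo y y' μ) (a3 : 0 < oo y y' ν)
    (b1 : ∀ w ∈ Y, 0 < oo y μ w) (b2 : 0 < oo y μ ν)
    (c1 : ∀ w ∈ Y, 0 < oo y ν w)
    (t1 : oo y' μ ν < 0) (d2 : 0 < oo μ ν z)
    (d1 : ∀ w ∈ Y, w ≠ z → oo ν z w < 0) :
    PlaneL (y :: y' :: ν :: μ :: z :: l) ∧ PlaneL (y' :: μ :: y :: ν :: z' :: l') := by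
  obtain ⟨g1, g2, g3, g4, g5, g6, g7⟩ := hG
  have zY : z ∈ Y := (g3 z).1 (by simp)
  have hl : ∀ w ∈ l, w ∈ Y ∧ w ≠ z := fun w hw => ⟨(g3 w).1 (by simp [hw]), by
    rintro rfl; exact (List.nodup_cons.1 g1).1 hw⟩
  have t2 : oo μ ν y' < 0 := by rw [← oo_cyc]; exact t1
  have u1 : oo y ν μ < 0 := by rw [oo_swap']; linarith
  have u2 : oo y ν y' < 0 := by rw [oo_swap']; linarith
  constructor
  · refine plane_cons (plane_cons (plane_cons (plane_cons g5 ?_) ?_) ?_) ?_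
    · refine av2 ν z (-1) ?_ (by simp) ?_
      · rw [← oo_cyc]; linarith
      · intro w hw; have := d1 w (hl w hw).1 (hl w hw).2; linarith
    · intro c d h
      rw [Ed_cons] at h
      have e0 : NC ν μ μ z := sep μ ν 1 (by simp) (by simp) (by simp) (by linarith)
        (by right; right; right; linarith)
      rcases h with ⟨rfl, rfl⟩ | ⟨rfl, rfl⟩ | h
      · exact e0
      · exact NC_flip' e0
      · have hm := Ed_mem _ _ _ h
        have q1 := c1 c ((g3 c).1 hm.1)
        have q2 := c1 d ((g3 d).1 hm.2)
        exact sep y ν 1 (by simp) (by linarith) (by linarith) (by linarith)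
          (by right; left; linarith)
    · intro c d h
      rw [Ed_cons, Ed_cons] at h
      have e0 : NC y' ν ν μ := sep μ ν 1 (by linarith) (by simp) (by simp) (by simp)
        (by left; linarith)
      have e1 : NC y' ν μ z := sep μ ν 1 (by linarith) (by simp) (by simp) (by linarith)
        (by left; linarith)
      rcases h with ⟨rfl, rfl⟩ | ⟨rfl, rfl⟩ | ⟨rfl, rfl⟩ | ⟨rfl, rfl⟩ | h
      · exact e0
      · exact NC_flip' e0
      · exact e1
      · exact NC_flip' e1
      · have hm := Ed_mem _ _ _ h
        have q1 := c1 c ((g3 c).1 hm.1)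
        have q2 := c1 d ((g3 d).1 hm.2)
        exact sep y ν 1 (by linarith) (by simp) (by linarith) (by linarith)
          (by left; linarith)
    · refine av1 y y' 1 (by simp) (by simp) ?_
      rw [List.forall_mem_cons, List.forall_mem_cons]
      refine ⟨by linarith, by linarith, ?_⟩
      intro w hw; have := a1 w ((g3 w).1 hw); linarith
  · refine plane_cons (plane_cons (plane_cons (plane_cons g6 hN) ?_) ?_) ?_
    · refine av1 y ν 1 (by simp) (by simp) ?_
      intro w hw; have := c1 w ((g4 w).1 hw); linarith
    · refine av1 y μ 1 (by simp) (by simp) ?_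
      rw [List.forall_mem_cons]
      refine ⟨by linarith, ?_⟩
      intro w hw; have := b1 w ((g4 w).1 hw); linarith
    · refine av2 y μ 1 ?_ (by simp) ?_
      · rw [oo_swap']; linarith
      · rw [List.forall_mem_cons, List.forall_mem_cons]
        refine ⟨by simp, by linarith, ?_⟩
        intro w hw; have := b1 w ((g4 w).1 hw); linarith

lemma caseD {Y : Finset Pt} {y y' μ ν z z' : Pt} {l l' : List Pt}
    (hG : Good Y z z' l l') (hN : ∀ c d, Ed (z' :: l') c d → NC ν z' c d)
    (a1 : ∀ w ∈ Y, 0 < oo y y' w) (a2 : 0 < oo y y' μ) (a3 : 0 < oo y y' ν)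
    (b2 : 0 < oo y μ ν)
    (c1 : ∀ w ∈ Y, 0 < oo y ν w)
    (t1 : oo y' μ ν < 0) (t2 : ∀ w ∈ Y, oo y' μ w < 0)
    (d2 : ∀ w ∈ Y, oo μ ν w < 0)
    (d1 : ∀ w ∈ Y, w ≠ z → 0 < oo ν z w) :
    PlaneL (y' :: y :: ν :: μ :: z :: l) ∧ PlaneL (y :: μ :: y' :: ν :: z' :: l') := by
  obtain ⟨g1, g2, g3, g4, g5, g6, g7⟩ := hG
  have zY : z ∈ Y := (g3 z).1 (by simp)
  have hl : ∀ w ∈ l, w ∈ Y ∧ w ≠ z := fun w hw => ⟨(g3 w).1 (by simp [hw]), by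
    rintro rfl; exact (List.nodup_cons.1 g1).1 hw⟩
  have u2 : oo y ν y' < 0 := by rw [oo_swap']; linarith
  constructor
  · refine plane_cons (plane_cons (plane_cons (plane_cons g5 ?_) ?_) ?_) ?_
    · refine av2 ν z 1 ?_ (by simp) ?_
      · rw [← oo_cyc]; linarith [d2 z zY]
      · intro w hw; have := d1 w (hl w hw).1 (hl w hw).2; linarith
    · refine av1 μ ν (-1) (by simp) (by simp) ?_
      intro w hw; have := d2 w ((g3 w).1 hw); linarith
    · refine av2 μ ν (-1) ?_ (by simp) ?_
      · rw [← oo_cyc]; linarith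
      · rw [List.forall_mem_cons]
        refine ⟨by simp, ?_⟩
        intro w hw; have := d2 w ((g3 w).1 hw); linarith
    · refine av1 y y' 1 (by simp) (by simp) ?_
      rw [List.forall_mem_cons, List.forall_mem_cons]
      refine ⟨by linarith, by linarith, ?_⟩
      intro w hw; have := a1 w ((g3 w).1 hw); linarith
  · refine plane_cons (plane_cons (plane_cons (plane_cons g6 hN) ?_) ?_) ?_
    · refine av2 y ν 1 (by linarith) (by simp) ?_
      intro w hw; have := c1 w ((g4 w).1 hw); linarith
    · refine av1 y' μ (-1) (by simp) (by simp) ?_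
      rw [List.forall_mem_cons]
      refine ⟨by linarith, ?_⟩
      intro w hw; have := t2 w ((g4 w).1 hw); linarith
    · refine av2 y' μ (-1) ?_ (by simp) ?_
      · rw [← oo_cyc]; linarith
      · rw [List.forall_mem_cons, List.forall_mem_cons]
        refine ⟨by simp, by linarith, ?_⟩
        intro w hw; have := t2 w ((g4 w).1 hw); linarith

lemma adj {a b c : Pt} (h : oo a b c ≠ 0) : NC a b b c := by
  have h' : oo b c a ≠ 0 := by rwa [← oo_cyc]
  have h2 : 0 < oo b c a * oo b c a := mul_self_pos.2 h'
  exact sep b c (- oo b c a) (by linarith) (by simp) (by simp) (by simp) (by left; linarith)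

lemma four {W : Finset Pt} {y y' μ ν : Pt}
    (hW : ∀ w, w ∈ W ↔ w = y ∨ w = y' ∨ w = μ ∨ w = ν)
    (h1 : y ≠ y') (h2 : y ≠ μ) (h3 : y ≠ ν) (h4 : y' ≠ μ)
    (h5 : y' ≠ ν) (h6 : μ ≠ ν)
    (a2 : 0 < oo y y' μ) (a3 : 0 < oo y y' ν) (b2 : 0 < oo y μ ν) (c2 : oo y' ν μ ≠ 0) :
    Good W y y' [y', ν, μ] [μ, y, ν] := by
  refine ⟨?_, ?_, ?_, ?_, ?_, ?_, ?_⟩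
  · simp; grind
  · simp; grind
  · intro w; rw [hW]; simp; tauto
  · intro w; rw [hW]; simp
    constructor
    · rintro (h | h | h | h) <;> simp [h]
    · rintro (h | h | h | h) <;> simp [h]
  · refine plane_cons (plane_cons (plane_cons (plane_single _) (by simp)) ?_) ?_
    · intro c d h
      simp only [Ed_cons, Ed_single, or_false] at h
      rcases h with ⟨rfl, rfl⟩ | ⟨rfl, rfl⟩
      · exact adj c2
      · exact NC_flip' (adj c2)
    · refine av1 y y' 1 (by simp) (by simp) ?_
      simp [a2, a3]
  · refine plane_cons (plane_cons (plane_cons (plane_single _) (by simp)) ?_) ?_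
    · refine av1 y μ 1 (by simp) (by simp) ?_
      simp [b2]
    · refine av2 y μ 1 (by rw [oo_swap']; linarith) (by simp) ?_
      simp [b2.le]
  · intro c d h h'
    simp only [Ed_cons, Ed_single, or_false] at h h'
    rcases h with h | h | h | h | h | h <;>
      rcases h' with h' | h' | h' | h' | h' | h' <;> grind

lemma six {W : Finset Pt} {y y' μ ν w ρ : Pt}
    (hW : ∀ x, x ∈ W ↔ x = y ∨ x = y' ∨ x = μ ∨ x = ν ∨ x = w ∨ x = ρ)
    (hn : [y, y', μ, ν, w, ρ].Nodup) (s : ℝ)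
    (a2 : 0 < oo y y' μ) (a3 : 0 < oo y y' ν) (a4 : 0 < oo y y' w) (a5 : 0 < oo y y' ρ)
    (b2 : 0 < oo y μ ν) (b3 : 0 < oo y μ w) (b4 : 0 < oo y μ ρ)
    (c1 : s * oo μ ν y' < 0) (c2 : 0 < s * oo μ ν w) (c3 : 0 < s * oo μ ν ρ)
    (d1 : oo μ w ρ ≠ 0) (d2 : oo ρ ν w ≠ 0) (d3 : oo y ρ ν ≠ 0) (e : NC y ρ ν w) :
    Good W y y' [y', ν, μ, w, ρ] [μ, y, ρ, ν, w] := by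
  simp only [List.nodup_cons, List.mem_cons, List.not_mem_nil, or_false, not_or] at hn
  obtain ⟨⟨n1, n2, n3, n4, n5⟩, ⟨n6, n7, n8, n9⟩, ⟨n10, n11, n12⟩, ⟨n13, n14⟩, n15, -⟩ := hn
  refine ⟨?_, ?_, ?_, ?_, ?_, ?_, ?_⟩
  · simp only [List.nodup_cons, List.mem_cons, List.not_mem_nil, or_false, not_or, List.nodup_nil]
    grind
  · simp only [List.nodup_cons, List.mem_cons, List.not_mem_nil, or_false, not_or, List.nodup_nil]
    grind
  · intro x; rw [hW]; simp only [List.mem_cons, List.not_mem_nil, or_false]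
    constructor
    · rintro (h | h | h | h | h | h) <;> simp [h]
    · rintro (h | h | h | h | h | h) <;> simp [h]
  · intro x; rw [hW]; simp only [List.mem_cons, List.not_mem_nil, or_false]
    constructor
    · rintro (h | h | h | h | h | h) <;> simp [h]
    · rintro (h | h | h | h | h | h) <;> simp [h]
  · refine plane_cons (plane_cons (plane_cons (plane_cons (plane_cons (plane_single _)
      (by simp)) ?_) ?_) ?_) ?_
    · intro c d h
      simp only [Ed_cons, Ed_single, or_false] at h
      rcases h with ⟨rfl, rfl⟩ | ⟨rfl, rfl⟩
      · exact adj d1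
      · exact NC_flip' (adj d1)
    · refine av1 μ ν s (by simp) (by simp) ?_
      simp [c2, c3]
    · refine av2 μ ν s c1 (by simp) ?_
      simp [c2.le, c3.le]
    · refine av1 y y' 1 (by simp) (by simp) ?_
      simp [a2, a3, a4, a5]
  · refine plane_cons (plane_cons (plane_cons (plane_cons (plane_cons (plane_single _)
      (by simp)) ?_) ?_) ?_) ?_
    · intro c d h
      simp only [Ed_cons, Ed_single, or_false] at h
      rcases h with ⟨rfl, rfl⟩ | ⟨rfl, rfl⟩
      · exact adj d2
      · exact NC_flip' (adj d2)
    · intro c d h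
      simp only [Ed_cons, Ed_single, or_false] at h
      rcases h with ⟨rfl, rfl⟩ | ⟨rfl, rfl⟩ | ⟨rfl, rfl⟩ | ⟨rfl, rfl⟩
      · exact adj d3
      · exact NC_flip' (adj d3)
      · exact e
      · exact NC_flip' e
    · refine av1 y μ 1 (by simp) (by simp) ?_
      simp [b2, b3, b4]
    · refine av2 y μ 1 (by rw [oo_swap']; linarith) (by simp) ?_
      simp [b2.le, b3.le, b4.le]
  · intro c d h h'
    simp only [Ed_cons, Ed_single, or_false] at h h'
    clear a2 a3 a4 a5 b2 b3 b4 c1 c2 c3 d1 d2 d3 e hW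
    rcases h with h | h | h | h | h | h | h | h | h | h <;>
      rcases h' with h' | h' | h' | h' | h' | h' | h' | h' | h' | h' <;> grind

lemma choose_rho {y y' ν s t : Pt} (a1 : 0 < oo y y' ν) (a2 : 0 < oo y y' s)
    (a3 : 0 < oo y y' t) (n1 : oo y s ν ≠ 0) (n2 : oo y s t ≠ 0) (n3 : oo y t ν ≠ 0) :
    NC y s ν t ∨ NC y t ν s := by
  have key : ∀ s t : Pt, 0 < oo y s ν * oo y s t → NC y s ν t := by
    intro s t h
    refine sep y s (oo y s ν) (by simp) (by simp) (mul_self_nonneg _) h.le ?_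
    right; right; right; exact h
  by_cases h1 : 0 < oo y s ν * oo y s t
  · exact Or.inl (key s t h1)
  by_cases h2 : 0 < oo y t ν * oo y t s
  · exact Or.inr (key t s h2)
  exfalso
  rw [oo_swap' y t s] at h2
  have e := plk y y' s t ν
  rcases lt_or_gt_of_ne n2 with hb | hb
  · have ha : 0 < oo y s ν := by
      rcases lt_or_gt_of_ne n1 with h | h
      · exact absurd (mul_pos_of_neg_of_neg h hb) h1
      · exact h
    have hc : oo y t ν < 0 := by
      rcases lt_or_gt_of_ne n3 with h | h
      · exact h
      · exact absurd (mul_pos h (by linarith)) h2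
    have := mul_pos a2 (neg_pos.2 hc)
    have := mul_pos a3 ha
    have := mul_pos a1 (neg_pos.2 hb)
    linarith
  · have ha : oo y s ν < 0 := by
      rcases lt_or_gt_of_ne n1 with h | h
      · exact h
      · exact absurd (mul_pos h hb) h1
    have hc : 0 < oo y t ν := by
      rcases lt_or_gt_of_ne n3 with h | h
      · exact absurd (mul_pos_of_neg_of_neg h (by linarith)) h2
      · exact h
    have := mul_pos a2 hc
    have := mul_pos a3 (neg_pos.2 ha)
    have := mul_pos a1 hb
    linarith

set_option maxHeartbeats 4000000 in
lemma main_step (m : ℕ) (ih : IHm m) (W : Finset Pt) (hm : W.card = m) (h4 : 4 ≤ m)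
    (hmod : m % 4 ≠ 3) (gp : GPs W) (y : Pt) (hy : y ∈ W) (y' : Pt) (hy' : y' ∈ W)
    (hyy : y ≠ y') (hpos : ∀ w ∈ W, w ≠ y → w ≠ y' → 0 < oo y y' w) :
    ∃ l l', Good W y y' l l' := by
  obtain ⟨U, hUd⟩ : ∃ U, U = (W.erase y).erase y' := ⟨_, rfl⟩
  have hU : ∀ w, w ∈ U ↔ w ≠ y' ∧ w ≠ y ∧ w ∈ W := by
    intro w; rw [hUd, Finset.mem_erase, Finset.mem_erase]
  have cU : U.card = m - 2 := by
    rw [hUd, Finset.card_erase_of_mem (Finset.mem_erase.2 ⟨hyy.symm, hy'⟩),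
      Finset.card_erase_of_mem hy, hm]
    omega
  have UW : U ⊆ W := fun w hw => ((hU w).1 hw).2.2
  have Upos : ∀ w ∈ U, 0 < oo y y' w := fun w hw =>
    hpos w (UW hw) ((hU w).1 hw).2.1 ((hU w).1 hw).1
  have Upos' : ∀ w ∈ U, 0 < (-1) * oo y' y w := fun w hw => by
    rw [oo_swap]; linarith [Upos w hw]
  have yU : y ∉ U := fun h => ((hU y).1 h).2.1 rfl
  have y'U : y' ∉ U := fun h => ((hU y').1 h).1 rfl
  obtain ⟨μ, hμ, hμ2⟩ := ext_ang y y' (-1) 1 one_ne_zero U (Finset.card_pos.1 (by omega)) yU gp hy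
    UW Upos'
  obtain ⟨Y1, hY1d⟩ : ∃ Y1, Y1 = U.erase μ := ⟨_, rfl⟩
  have hY1 : ∀ w, w ∈ Y1 ↔ w ≠ μ ∧ w ∈ U := by
    intro w; rw [hY1d, Finset.mem_erase]
  have cY1 : Y1.card = m - 3 := by
    rw [hY1d, Finset.card_erase_of_mem hμ]; omega
  have Y1U : Y1 ⊆ U := fun w hw => ((hY1 w).1 hw).2
  have bpos : ∀ w ∈ Y1, 0 < oo y μ w := fun w hw => by
    have := hμ2 w (Y1U hw) ((hY1 w).1 hw).1; linarith
  have bpos' : ∀ w ∈ Y1, 0 < 1 * oo y μ w := fun w hw => by linarith [bpos w hw]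
  have μY1 : μ ∉ Y1 := fun h => ((hY1 μ).1 h).1 rfl
  have yμ : y ≠ μ := fun h => yU (h ▸ hμ)
  have y'μ : y' ≠ μ := fun h => y'U (h ▸ hμ)
  have yY1 : y ∉ Y1 := fun h => yU (Y1U h)
  have y'Y1 : y' ∉ Y1 := fun h => y'U (Y1U h)
  have μW := UW hμ
  have hW1 : ∀ w, w ∈ W ↔ w = y ∨ w = y' ∨ w = μ ∨ w ∈ Y1 := by
    intro w
    rw [hY1, hU]
    constructor
    · intro h
      by_cases e1 : w = y <;> by_cases e2 : w = y' <;> by_cases e3 : w = μ <;> simp [e1, e2, e3, h]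
    · rintro (rfl | rfl | rfl | h)
      · exact hy
      · exact hy'
      · exact μW
      · exact h.2.2.2
  have nY1 : Y1.Nonempty := Finset.card_pos.1 (by omega)
  have Y1W : Y1 ⊆ W := Y1U.trans UW
  have neg1 : oo y μ y' < 0 := by rw [oo_swap']; linarith [Upos μ hμ]
  by_cases m4 : m = 4
  · obtain ⟨ν, hν⟩ := Finset.card_eq_one.1 (show Y1.card = 1 by omega)
    have νY : ν ∈ Y1 := by rw [hν]; simp
    have y'ν : y' ≠ ν := fun h => y'Y1 (h ▸ νY)
    have μν : μ ≠ ν := fun h => μY1 (h ▸ νY)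
    refine ⟨_, _, four (ν := ν) (μ := μ) ?_ hyy yμ (fun h => yY1 (h ▸ νY)) y'μ y'ν μν (Upos _ hμ)
      (Upos _ (Y1U νY)) (bpos _ νY) (gp _ hy' _ (Y1W νY) _ μW y'ν y'μ μν.symm)⟩
    intro w; rw [hW1, hν, Finset.mem_singleton]
  -- extraction of a second point
  have split : ∀ ν ∈ Y1, ∃ Y : Finset Pt, (∀ w, w ∈ Y ↔ w ≠ ν ∧ w ∈ Y1) ∧ Y.card = m - 4 := by
    intro ν hν
    exact ⟨Y1.erase ν, fun w => Finset.mem_erase, by rw [Finset.card_erase_of_mem hν]; omega⟩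
  have dist : ∀ ν ∈ Y1, y ≠ ν ∧ y' ≠ ν ∧ μ ≠ ν := fun ν hν =>
    ⟨fun h => yY1 (h ▸ hν), fun h => y'Y1 (h ▸ hν), fun h => μY1 (h ▸ hν)⟩
  have hWY : ∀ ν ∈ Y1, ∀ Y : Finset Pt, (∀ w, w ∈ Y ↔ w ≠ ν ∧ w ∈ Y1) →
      ∀ w, w ∈ W ↔ w = y ∨ w = y' ∨ w = μ ∨ w = ν ∨ w ∈ Y := by
    intro ν hν Y hY w
    rw [hW1, hY]
    by_cases e : w = ν
    · subst e; simp [hν]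
    · simp [e]
  have hcard : ∀ Y : Finset Pt, Y.card = m - 4 → m ≠ 6 →
      Y.card = 1 ∨ (4 ≤ Y.card ∧ Y.card % 4 ≠ 3 ∧ Y.card < m) := by
    intro Y h h6
    omega
  by_cases nt : ∃ w0 ∈ Y1, 0 < oo y' μ w0
  · obtain ⟨w0, hw0, hw0p⟩ := nt
    obtain ⟨ν, hν, hν2⟩ := ext_ang μ y 1 (-1) (by norm_num) Y1 nY1 μY1 gp μW Y1W bpos'
    obtain ⟨Y, hY, cY⟩ := split ν hν
    obtain ⟨yν, y'ν, μν⟩ := dist ν hν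
    have hW2 := hWY ν hν Y hY
    have YY1 : Y ⊆ Y1 := fun w hw => ((hY w).1 hw).2
    have νY : ν ∉ Y := fun h => ((hY ν).1 h).1 rfl
    have cneg : ∀ w ∈ Y, oo μ ν w < 0 := fun w hw => by
      linarith [hν2 w (YY1 hw) ((hY w).1 hw).1]
    have cν : 0 < oo y' μ ν := by
      by_cases e : w0 = ν
      · rw [← e]; exact hw0p
      · exact left_of_left μ y' y ν w0 hw0p (by linarith [hν2 w0 hw0 e]) (bpos _ hν)
          (bpos _ hw0) neg1
    by_cases m6 : m = 6
    · obtain ⟨s, t, hst, hYst⟩ := Finset.card_eq_two.1 (show Y.card = 2 by omega)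
      have sY : s ∈ Y := by rw [hYst]; simp
      have tY : t ∈ Y := by rw [hYst]; simp
      obtain ⟨ys, y's, μs⟩ := dist s (YY1 sY)
      obtain ⟨yt, y't, μt⟩ := dist t (YY1 tY)
      have sν : s ≠ ν := ((hY s).1 sY).1
      have tν : t ≠ ν := ((hY t).1 tY).1
      have sW := Y1W (YY1 sY)
      have tW := Y1W (YY1 tY)
      have νW := Y1W hν
      have q : oo μ ν y' = oo y' μ ν := (oo_cyc _ _ _).symm
      rcases choose_rho (Upos _ (Y1U hν)) (Upos _ (Y1U (YY1 sY))) (Upos _ (Y1U (YY1 tY)))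
        (gp _ hy _ sW _ νW ys yν sν) (gp _ hy _ sW _ tW ys yt hst)
        (gp _ hy _ tW _ νW yt yν tν) with hnc | hnc
      · refine ⟨_, _, six (W := W) (y := y) (y' := y') (μ := μ) (ν := ν) (w := t) (ρ := s) ?_ ?_ (-1) (Upos _ hμ) (Upos _ (Y1U hν))
          (Upos _ (Y1U (YY1 tY))) (Upos _ (Y1U (YY1 sY))) (bpos _ hν) (bpos _ (YY1 tY))
          (bpos _ (YY1 sY)) (by rw [q]; linarith) (by linarith [cneg t tY])
          (by linarith [cneg s sY]) (gp _ μW _ tW _ sW μt μs hst.symm)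
          (gp _ sW _ νW _ tW sν hst tν.symm) (gp _ hy _ sW _ νW ys yν sν) hnc⟩
        · intro x; rw [hW2, hYst, Finset.mem_insert, Finset.mem_singleton]; tauto
        · simp; grind
      · refine ⟨_, _, six (W := W) (y := y) (y' := y') (μ := μ) (ν := ν) (w := s) (ρ := t) ?_ ?_ (-1) (Upos _ hμ) (Upos _ (Y1U hν))
          (Upos _ (Y1U (YY1 sY))) (Upos _ (Y1U (YY1 tY))) (bpos _ hν) (bpos _ (YY1 sY))
          (bpos _ (YY1 tY)) (by rw [q]; linarith) (by linarith [cneg s sY])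
          (by linarith [cneg t tY]) (gp _ μW _ sW _ tW μs μt hst)
          (gp _ tW _ νW _ sW tν hst.symm sν.symm) (gp _ hy _ tW _ νW yt yν tν) hnc⟩
        · intro x; rw [hW2, hYst, Finset.mem_insert, Finset.mem_singleton]
        · simp; grind
    · have nY : Y.Nonempty := Finset.card_pos.1 (by omega)
      obtain ⟨z, hz, hz2⟩ := ext_ang ν μ (-1) 1 one_ne_zero Y nY νY gp (Y1W hν) (YY1.trans Y1W)
        (fun w hw => by linarith [cneg w hw])
      obtain ⟨z', l, l', hG, hN, -⟩ := Next m ih Y ν z (gp.mono (YY1.trans Y1W)) hz 1 (Or.inl rfl)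
        hz2 (hcard Y cY m6)
      obtain ⟨p1, p2⟩ := caseA1 hG hN (fun w hw => Upos w (Y1U (YY1 hw))) (Upos _ hμ)
        (Upos _ (Y1U hν)) (fun w hw => bpos w (YY1 hw)) (bpos _ hν) cneg cν
        (fun w hw hwz => by linarith [hz2 w hw hwz])
      exact ⟨_, _, assemble hW2 hG hyy yμ yν y'μ y'ν μν (fun h => yY1 (YY1 h))
        (fun h => y'Y1 (YY1 h)) (fun h => μY1 (YY1 h)) νY p1 p2⟩
  · push Not at nt
    have tip : ∀ w ∈ Y1, oo y' μ w < 0 := fun w hw =>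
      lt_of_le_of_ne (nt w hw) (gp _ hy' _ μW _ (Y1W hw) y'μ (dist w hw).2.1 (dist w hw).2.2)
    by_cases m6 : m = 6
    · obtain ⟨n1, hn1, hn1p⟩ := ext_ang μ y 1 (-1) (by norm_num) Y1 nY1 μY1 gp μW Y1W bpos'
      obtain ⟨Y, hY, cY⟩ := split n1 hn1
      have hW2 := hWY n1 hn1 Y hY
      have YY1 : Y ⊆ Y1 := fun w hw => ((hY w).1 hw).2
      obtain ⟨n2, hn2, hn2p⟩ := ext_ang μ y 1 1 one_ne_zero Y (Finset.card_pos.1 (by omega))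
        (fun h => μY1 (YY1 h)) gp μW (YY1.trans Y1W) (fun w hw => bpos' w (YY1 hw))
      obtain ⟨w, hw⟩ := Finset.card_eq_one.1 (show (Y.erase n2).card = 1 by
        rw [Finset.card_erase_of_mem hn2]; omega)
      have wY2 : w ∈ Y.erase n2 := by rw [hw]; simp
      obtain ⟨wn2, wY⟩ := Finset.mem_erase.1 wY2
      have n2n1 : n2 ≠ n1 := ((hY n2).1 hn2).1
      have wn1 : w ≠ n1 := ((hY w).1 wY).1
      obtain ⟨yw, y'w, μw⟩ := dist w (YY1 wY)
      obtain ⟨yn1, y'n1, μn1⟩ := dist n1 hn1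
      obtain ⟨yn2, y'n2, μn2⟩ := dist n2 (YY1 hn2)
      have wW := Y1W (YY1 wY)
      have n1W := Y1W hn1
      have n2W := Y1W (YY1 hn2)
      have k1 := hn1p n2 (YY1 hn2) n2n1
      have k2 := hn1p w (YY1 wY) wn1
      have k3 := hn2p w wY wn2
      have k4 : oo μ n2 n1 = - oo μ n1 n2 := oo_swap' _ _ _
      have k5 : oo μ n1 y = oo y μ n1 := (oo_cyc _ _ _).symm
      have k6 := bpos n1 hn1
      have k7 : oo μ n2 y' = oo y' μ n2 := (oo_cyc _ _ _).symm
      refine ⟨_, _, six (W := W) (y := y) (y' := y') (μ := μ) (ν := n2) (w := w) (ρ := n1) ?_ ?_ 1 (Upos _ hμ)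
        (Upos _ (Y1U (YY1 hn2))) (Upos _ (Y1U (YY1 wY))) (Upos _ (Y1U hn1)) (bpos _ (YY1 hn2))
        (bpos _ (YY1 wY)) k6 (by rw [k7]; linarith [tip n2 (YY1 hn2)]) (by linarith)
        (by linarith) (gp _ μW _ wW _ n1W μw μn1 wn1)
        (gp _ n1W _ n2W _ wW n2n1.symm wn1.symm wn2.symm)
        (gp _ hy _ n1W _ n2W yn1 yn2 n2n1.symm) ?_⟩
      · intro x
        have : x ∈ Y ↔ x = n2 ∨ x = w := by
          have e2 : x ∈ Y.erase n2 ↔ x = w := by rw [hw, Finset.mem_singleton]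
          rw [Finset.mem_erase] at e2
          rw [← e2]
          by_cases e : x = n2
          · subst e; simp [hn2]
          · simp [e]
        rw [hW2, this]; tauto
      · simp; grind
      · exact sep μ n1 (-1) (by rw [k5]; linarith) (by simp) (by linarith) (by linarith)
          (by right; right; left; linarith)
    · obtain ⟨ν, hν, hν2⟩ := ext_ang y y' (-1) 1 one_ne_zero Y1 nY1 yY1 gp hy Y1W
        (fun w hw => Upos' w (Y1U hw))
      obtain ⟨Y, hY, cY⟩ := split ν hν
      obtain ⟨yν, y'ν, μν⟩ := dist ν hν
      have hW2 := hWY ν hν Y hY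
      have YY1 : Y ⊆ Y1 := fun w hw => ((hY w).1 hw).2
      have νY : ν ∉ Y := fun h => ((hY ν).1 h).1 rfl
      have cpos : ∀ w ∈ Y, 0 < oo y ν w := fun w hw => by
        linarith [hν2 w (YY1 hw) ((hY w).1 hw).1]
      have nY : Y.Nonempty := Finset.card_pos.1 (by omega)
      by_cases cL : ∃ w0 ∈ Y, 0 < oo μ ν w0
      · obtain ⟨w0, hw0, hw0p⟩ := cL
        obtain ⟨z, hz, hz2⟩ := ext_ang ν y 1 (-1) (by norm_num) Y nY νY gp (Y1W hν)
          (YY1.trans Y1W) (fun w hw => by linarith [cpos w hw])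
        have zpos : 0 < oo μ ν z := by
          by_cases e : w0 = z
          · rw [← e]; exact hw0p
          · exact left_of_left ν μ y z w0 hw0p (by linarith [hz2 w0 hw0 e]) (cpos _ hz)
              (cpos _ hw0) (by rw [oo_swap']; linarith [bpos ν hν])
        obtain ⟨z', l, l', hG, hN, -⟩ := Next m ih Y ν z (gp.mono (YY1.trans Y1W)) hz (-1)
          (Or.inr rfl) hz2 (hcard Y cY m6)
        obtain ⟨p1, p2⟩ := caseA2 hG hN (fun w hw => Upos w (Y1U (YY1 hw))) (Upos _ hμ)
          (Upos _ (Y1U hν)) (fun w hw => bpos w (YY1 hw)) (bpos _ hν) cpos (tip ν hν) zpos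
          (fun w hw hwz => by linarith [hz2 w hw hwz])
        exact ⟨_, _, assemble hW2 hG hyy yμ yν y'μ y'ν μν (fun h => yY1 (YY1 h))
          (fun h => y'Y1 (YY1 h)) (fun h => μY1 (YY1 h)) νY p1 p2⟩
      · push Not at cL
        have cneg : ∀ w ∈ Y, oo μ ν w < 0 := fun w hw =>
          lt_of_le_of_ne (cL w hw) (gp _ μW _ (Y1W hν) _ (Y1W (YY1 hw)) μν
            (dist w (YY1 hw)).2.2 ((hY w).1 hw).1.symm)
        obtain ⟨z, hz, hz2⟩ := ext_ang ν y 1 1 one_ne_zero Y nY νY gp (Y1W hν)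
          (YY1.trans Y1W) (fun w hw => by linarith [cpos w hw])
        obtain ⟨z', l, l', hG, hN, -⟩ := Next m ih Y ν z (gp.mono (YY1.trans Y1W)) hz 1
          (Or.inl rfl) hz2 (hcard Y cY m6)
        obtain ⟨p1, p2⟩ := caseD hG hN (fun w hw => Upos w (Y1U (YY1 hw))) (Upos _ hμ)
          (Upos _ (Y1U hν)) (bpos _ hν) cpos (tip ν hν) (fun w hw => tip w (YY1 hw)) cneg
          (fun w hw hwz => by linarith [hz2 w hw hwz])
        have hW3 : ∀ w, w ∈ W ↔ w = y' ∨ w = y ∨ w = μ ∨ w = ν ∨ w ∈ Y := by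
          intro w; rw [hW2]; tauto
        exact ⟨_, _, (assemble hW3 hG hyy.symm y'μ y'ν yμ yν μν (fun h => y'Y1 (YY1 h))
          (fun h => yY1 (YY1 h)) (fun h => μY1 (YY1 h)) νY p1 p2).symm⟩

lemma ih_all (m : ℕ) : IHm m := by
  induction m using Nat.strong_induction_on with
  | _ m ih =>
    intro W hW h4 hmod gp y hy y' hy' hyy hpos
    exact main_step W.card (ih W.card hW) W rfl h4 hmod gp y hy y' hy' hyy hpos

lemma Ed_head_unique {h a b : Pt} {l : List Pt} (hn : (h :: l).Nodup) (h1 : Ed (h :: l) h a)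
    (h2 : Ed (h :: l) h b) : a = b := by
  have hh := (List.nodup_cons.1 hn).1
  cases l with
  | nil => simp at h1
  | cons k l =>
    have key : ∀ x, Ed (h :: k :: l) h x → x = k := by
      intro x hx
      rw [Ed_cons] at hx
      rcases hx with hx | hx | hx
      · exact hx.2
      · exact absurd (hx.1 ▸ List.mem_cons_self) hh
      · exact absurd (Ed_mem _ _ _ hx).1 hh
    rw [key a h1, key b h2]

lemma Ed_deg : ∀ (L : List Pt), L.Nodup → ∀ v a b c, Ed L v a → Ed L v b → Ed L v c →
    a = b ∨ a = c ∨ b = c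
  | [], _, v, a, b, c, h, _, _ => by simp at h
  | [x], _, v, a, b, c, h, _, _ => by simp at h
  | h :: k :: l, hn, v, a, b, c, ha, hb, hc => by
    have hn' := (List.nodup_cons.1 hn).2
    have hh := (List.nodup_cons.1 hn).1
    by_cases vh : v = h
    · subst vh
      exact Or.inl (Ed_head_unique hn ha hb)
    · have red : ∀ x, Ed (h :: k :: l) v x → (v = k ∧ x = h) ∨ Ed (k :: l) v x := by
        intro x hx
        rw [Ed_cons] at hx
        rcases hx with hx | hx | hx
        · exact absurd hx.1 vh
        · exact Or.inl hx
        · exact Or.inr hx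
      rcases red a ha with ⟨e1, e1'⟩ | a1 <;> rcases red b hb with ⟨e2, e2'⟩ | b1 <;>
        rcases red c hc with ⟨e3, e3'⟩ | c1
      · left; rw [e1', e2']
      · left; rw [e1', e2']
      · right; left; rw [e1', e3']
      · subst e1; right; right; exact Ed_head_unique hn' b1 c1
      · right; right; rw [e2', e3']
      · subst e2; right; left; exact Ed_head_unique hn' a1 c1
      · subst e3; left; exact Ed_head_unique hn' a1 b1
      · exact Ed_deg (k :: l) hn' v a b c a1 b1 c1

lemma Ed_card : ∀ (h : Pt) (l : List Pt),
    {e : Sym2 Pt | ∃ a b, Ed (h :: l) a b ∧ e = s(a, b)}.Finite ∧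
    {e : Sym2 Pt | ∃ a b, Ed (h :: l) a b ∧ e = s(a, b)}.ncard ≤ l.length
  | h, [] => by simp
  | h, k :: l => by
    obtain ⟨f, c⟩ := Ed_card k l
    have sub : {e : Sym2 Pt | ∃ a b, Ed (h :: k :: l) a b ∧ e = s(a, b)} ⊆
        insert s(h, k) {e : Sym2 Pt | ∃ a b, Ed (k :: l) a b ∧ e = s(a, b)} := by
      rintro e ⟨a, b, hab, rfl⟩
      rw [Ed_cons] at hab
      rcases hab with ⟨rfl, rfl⟩ | ⟨rfl, rfl⟩ | hab
      · exact Set.mem_insert _ _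
      · rw [Sym2.eq_swap]; exact Set.mem_insert _ _
      · exact Set.mem_insert_of_mem _ ⟨a, b, hab, rfl⟩
    refine ⟨(f.insert _).subset sub, ?_⟩
    calc _ ≤ _ := Set.ncard_le_ncard sub (f.insert _)
      _ ≤ _ := Set.ncard_insert_le _ _
      _ ≤ _ := by simpa using c

def listGraph (S : Finset Pt) (L : List Pt) (hn : L.Nodup) : SimpleGraph {x // x ∈ S} where
  Adj a b := Ed L a b
  symm := ⟨fun _ _ h => Ed_symm _ _ _ h⟩
  loopless := ⟨fun _ h => Ed_ne _ _ _ hn h rfl⟩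

lemma listGraph_reach (S : Finset Pt) (L : List Pt) (hn : L.Nodup) : ∀ (l : List Pt) (h : Pt)
    (hS : ∀ x ∈ h :: l, x ∈ S) (_ : ∀ c d, Ed (h :: l) c d → Ed L c d),
    ∀ x (hx : x ∈ h :: l), (listGraph S L hn).Reachable ⟨h, hS h List.mem_cons_self⟩ ⟨x, hS x hx⟩
  | [], h, hS, _, x, hx => by
    have : x = h := by simpa using hx
    subst this
    exact SimpleGraph.Reachable.refl _
  | k :: l, h, hS, hE, x, hx => by
    rcases List.mem_cons.1 hx with e | hx'
    · subst e; exact SimpleGraph.Reachable.refl _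
    · have h1 := listGraph_reach S L hn l k (fun x hx => hS x (List.mem_cons_of_mem _ hx))
        (fun c d hcd => hE c d (by rw [Ed_cons]; exact Or.inr (Or.inr hcd))) x hx'
      refine SimpleGraph.Reachable.trans (SimpleGraph.Adj.reachable ?_) h1
      exact hE h k (by rw [Ed_cons]; exact Or.inl ⟨rfl, rfl⟩)

lemma listGraph_path (S : Finset Pt) (h : Pt) (l : List Pt) (hn : (h :: l).Nodup)
    (hS : ∀ w, w ∈ h :: l ↔ w ∈ S) (hP : PlaneL (h :: l)) :
    IsPlaneSpanningPath (listGraph S (h :: l) hn) := by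
  refine ⟨⟨?_, ?_⟩, ?_⟩
  · have hne : Nonempty {x // x ∈ S} := ⟨⟨h, (hS h).1 List.mem_cons_self⟩⟩
    have hconn : (listGraph S (h :: l) hn).Connected := by
      refine SimpleGraph.Connected.mk ?_
      intro x y
      have key := fun (x : {x // x ∈ S}) => listGraph_reach S (h :: l) hn l h
        (fun x hx => (hS x).1 hx) (fun c d h => h) x.1 ((hS _).2 x.2)
      exact (key x).symm.trans (key y)
    rw [SimpleGraph.isTree_iff_connected_and_card]
    refine ⟨hconn, le_antisymm ?_ hconn.card_vert_le_card_edgeSet_add_one⟩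
    obtain ⟨f, c⟩ := Ed_card h l
    have hcard : Nat.card {x // x ∈ S} = l.length + 1 := by
      have : S = (h :: l).toFinset := by
        ext w; rw [List.mem_toFinset, hS]
      rw [Nat.card_eq_fintype_card, Fintype.card_coe, this, List.toFinset_card_of_nodup hn]
      simp
    rw [hcard]
    refine Nat.succ_le_succ (le_trans ?_ c)
    rw [Nat.card_coe_set_eq, ← Set.ncard_image_of_injective (listGraph S (h :: l) hn).edgeSet
      (Sym2.map.injective Subtype.val_injective)]
    refine Set.ncard_le_ncard ?_ f
    rintro e ⟨e', he', rfl⟩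
    induction e' using Sym2.ind with
    | _ a b => exact ⟨a.1, b.1, he', rfl⟩
  · intro a b c d h1 h2 h3
    refine hP _ _ _ _ h1 h2 ?_
    intro h4
    apply h3
    apply Sym2.map.injective (Subtype.val_injective (p := fun x => x ∈ S))
    simpa using h4
  · intro v a b c h1 h2 h3
    have := Ed_deg _ hn _ _ _ _ h1 h2 h3
    rcases this with h | h | h
    · exact Or.inl (Subtype.ext h)
    · exact Or.inr (Or.inl (Subtype.ext h))
    · exact Or.inr (Or.inr (Subtype.ext h))

lemma exists_hull_edge (S : Finset Pt) (gp : GPs S) (h : 2 ≤ S.card) :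
    ∃ p ∈ S, ∃ z ∈ S, p ≠ z ∧ ∀ w ∈ S, w ≠ p → w ≠ z → 0 < oo p z w := by
  obtain ⟨p, hp, hp2⟩ := ext_of_trans (fun a b => a.1 < b.1 ∨ (a.1 = b.1 ∧ a.2 < b.2)) S
    (Finset.card_pos.1 (by omega)) (by
      intro a _ b _ hab
      rcases lt_trichotomy a.1 b.1 with h | h | h
      · exact Or.inl (Or.inl h)
      · rcases lt_trichotomy a.2 b.2 with h' | h' | h'
        · exact Or.inl (Or.inr ⟨h, h'⟩)
        · exact absurd (Prod.ext h h') hab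
        · exact Or.inr (Or.inr ⟨h.symm, h'⟩)
      · exact Or.inr (Or.inl h)) (by
      intro a _ b _ c _ h1 h2
      rcases h1 with h1 | h1 <;> rcases h2 with h2 | h2
      · left; linarith
      · left; linarith [h2.1]
      · left; linarith [h1.1]
      · right; exact ⟨h1.1.trans h2.1, h1.2.trans h2.2⟩)
  obtain ⟨z, hz, hz2⟩ := ext_of_trans (fun a b => 0 < oo p a b) (S.erase p) (by
      rw [← Finset.card_pos, Finset.card_erase_of_mem hp]; omega) (by
      intro a ha b hb hab
      have ha' := Finset.mem_erase.1 ha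
      have hb' := Finset.mem_erase.1 hb
      have := gp p hp a ha'.2 b hb'.2 ha'.1.symm hb'.1.symm hab
      rw [oo_swap' p b a]
      rcases lt_or_gt_of_ne this with h | h
      · right; linarith
      · left; exact h) (by
      intro a ha z hz w hw h1 h2
      have ca := hp2 a (Finset.mem_of_mem_erase ha) (Finset.ne_of_mem_erase ha)
      have cz := hp2 z (Finset.mem_of_mem_erase hz) (Finset.ne_of_mem_erase hz)
      have cw := hp2 w (Finset.mem_of_mem_erase hw) (Finset.ne_of_mem_erase hw)
      have w0 : 0 ≤ w.1 - p.1 := by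
        rcases cw with h | h
        · linarith
        · linarith [h.1]
      have z1 : 0 < z.1 - p.1 := by
        rcases cz with h | h
        · linarith
        · exfalso
          have e : oo p z w = - ((z.2 - p.2) * (w.1 - p.1)) := by
            unfold oo; rw [h.1]; ring
          have := mul_nonneg (show 0 ≤ z.2 - p.2 by linarith [h.2]) w0
          linarith
      have a1 : 0 < a.1 - p.1 := by
        rcases ca with h | h
        · linarith
        · exfalso
          have e : oo p a z = - ((a.2 - p.2) * (z.1 - p.1)) := by
            unfold oo; rw [h.1]; ring
          have := mul_nonneg (show 0 ≤ a.2 - p.2 by linarith [h.2]) z1.le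
          linarith
      have e : oo p a w * (z.1 - p.1) = oo p a z * (w.1 - p.1) + oo p z w * (a.1 - p.1) := by
        unfold oo; ring
      have : 0 < oo p a w * (z.1 - p.1) := by
        rw [e]; exact add_pos_of_nonneg_of_pos (mul_nonneg h1.le w0) (mul_pos h2 a1)
      exact pos_of_mul_pos_left this z1.le)
  obtain ⟨hzp, hzS⟩ := Finset.mem_erase.1 hz
  exact ⟨p, hp, z, hzS, hzp.symm, fun w hw h1 h2 => hz2 w (Finset.mem_erase.2 ⟨h1, hw⟩) h2⟩

lemma exists_good (S : Finset Pt) (gp : GPs S) (h4 : 4 ≤ S.card) :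
    ∃ x x' l l', Good S x x' l l' := by
  obtain ⟨p, hp, z, hz, hpz, hpos⟩ := exists_hull_edge S gp (by omega)
  by_cases hmod : S.card % 4 = 3
  · have cY : (S.erase p).card = S.card - 1 := Finset.card_erase_of_mem hp
    obtain ⟨z', l, l', hG, hN, hzz⟩ := Next S.card (ih_all _) (S.erase p) p z
      (gp.mono (Finset.erase_subset _ _)) (Finset.mem_erase.2 ⟨hpz.symm, hz⟩) 1 (Or.inl rfl)
      (fun w hw hwz => by
        linarith [hpos w (Finset.mem_of_mem_erase hw) (Finset.ne_of_mem_erase hw) hwz])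
      (by right; omega)
    have hzz' := hzz (by omega)
    obtain ⟨g1, g2, g3, g4, g5, g6, g7⟩ := hG
    have mem : ∀ w, (w = p ∨ w ∈ S.erase p) ↔ w ∈ S := by
      intro w; rw [Finset.mem_erase]
      by_cases e : w = p
      · subst e; simp [hp]
      · simp [e]
    have hpY : p ∉ S.erase p := by simp
    refine ⟨p, p, z :: l, z' :: l', ?_, ?_, ?_, ?_, ?_, ?_, ?_⟩
    · rw [List.nodup_cons, g3]; exact ⟨hpY, g1⟩
    · rw [List.nodup_cons, g4]; exact ⟨hpY, g2⟩
    · intro w; rw [List.mem_cons, g3, mem]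
    · intro w; rw [List.mem_cons, g4, mem]
    · refine plane_cons g5 (av1 p z 1 (by simp) (by simp) ?_)
      intro w hw
      have h1 := (g3 w).1 (List.mem_cons_of_mem _ hw)
      have h2 : w ≠ z := by rintro rfl; exact (List.nodup_cons.1 g1).1 hw
      linarith [hpos w (Finset.mem_of_mem_erase h1) (Finset.ne_of_mem_erase h1) h2]
    · exact plane_cons g6 hN
    · intro c d h h'
      have e1 : Ed (z :: l) c d → c ∈ S.erase p ∧ d ∈ S.erase p := fun h =>
        ⟨(g3 c).1 (Ed_mem _ _ _ h).1, (g3 d).1 (Ed_mem _ _ _ h).2⟩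
      have e2 : Ed (z' :: l') c d → c ∈ S.erase p ∧ d ∈ S.erase p := fun h =>
        ⟨(g4 c).1 (Ed_mem _ _ _ h).1, (g4 d).1 (Ed_mem _ _ _ h).2⟩
      have e3 := g7 c d
      have zY : z ∈ S.erase p := (g3 z).1 (by simp)
      have zY' : z' ∈ S.erase p := (g4 z').1 (by simp)
      rw [Ed_cons] at h h'
      generalize Ed (z :: l) c d = A at *
      generalize Ed (z' :: l') c d = B at *
      generalize S.erase p = Y at *
      clear mem g1 g2 g3 g4 g5 g6 g7 hN hpos
      rcases h with h | h | h <;> rcases h' with h' | h' | h' <;> grind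
  · obtain ⟨l₁, l₂, hgood⟩ := ih_all (S.card + 1) S (by omega) h4 hmod gp p hp z hz hpz hpos
    exact ⟨p, z, l₁, l₂, hgood⟩

/-- Every set of `n ≥ 4` points in general position admits at least 2
pairwise edge-disjoint plane spanning paths. -/
theorem two_spanning_paths (S : Finset Pt) (n : ℕ) (hS : S.card = n) (hgp : GenPos S)
    (hn : 4 ≤ n) :
    ∃ P₁ P₂ : SimpleGraph {x // x ∈ S},
      IsPlaneSpanningPath P₁ ∧ IsPlaneSpanningPath P₂ ∧
      Disjoint P₁.edgeSet P₂.edgeSet := by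
  obtain ⟨x, x', l, l', g1, g2, g3, g4, g5, g6, g7⟩ :=
    exists_good S (gps_of_genPos hgp) (by omega)
  refine ⟨listGraph S (x :: l) g1, listGraph S (x' :: l') g2, listGraph_path S x l g1 g3 g5, listGraph_path S x' l' g2 g4 g6, ?_⟩
  rw [Set.disjoint_left]
  intro e
  induction e using Sym2.ind with
  | _ a b =>
    intro h1 h2
    exact g7 _ _ h1 h2
end

section
/- There exist absolute constants c₁ > 0 and c₂ > 0 such that the following holds: for every set S of n points in the plane in general position and every positive integer k with k ≤ √(n/12), there exist k pairwise edge-disjoint plane spanning trees T₁, …, T_k of S such that every vertex of every T_i has degree at most c₁·k², and the (graph-theoretic) diameter of every T_i is at most c₂·(1 + log₂(n/k²)). -/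
section helpers

/-- Tree from a parent function. -/
def parGraph {V : Type*} (r : V) (f : V → V) : SimpleGraph V :=
  SimpleGraph.fromRel (fun a b => a ≠ r ∧ f a = b)

lemma parGraph_adj {V : Type*} (r : V) (f : V → V) (a b : V) :
    (parGraph r f).Adj a b ↔ a ≠ b ∧ ((a ≠ r ∧ f a = b) ∨ (b ≠ r ∧ f b = a)) := by
  simp [parGraph, SimpleGraph.fromRel_adj]

lemma parGraph_walk {V : Type*} (r : V) (f : V → V) (dep : V → ℕ)
    (h : ∀ q, q ≠ r → dep (f q) < dep q) :
    ∀ m : ℕ, ∀ u, dep u ≤ m → ∃ w : (parGraph r f).Walk u r, w.length ≤ dep u := by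
  intro m
  induction m with
  | zero =>
    intro u hu
    by_cases hur : u = r
    · subst hur; exact ⟨SimpleGraph.Walk.nil, by simp⟩
    · have := h u hur; omega
  | succ m ih =>
    intro u hu
    by_cases hur : u = r
    · subst hur; exact ⟨SimpleGraph.Walk.nil, by simp⟩
    · have h1 := h u hur
      obtain ⟨w, hw⟩ := ih (f u) (by omega)
      have hadj : (parGraph r f).Adj u (f u) := by
        rw [parGraph_adj]
        refine ⟨?_, Or.inl ⟨hur, rfl⟩⟩
        intro he
        rw [← he] at h1
        omega
      exact ⟨SimpleGraph.Walk.cons hadj w, by simp; omega⟩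

lemma parGraph_dist {V : Type*} (r : V) (f : V → V) (dep : V → ℕ)
    (h : ∀ q, q ≠ r → dep (f q) < dep q) (u v : V) :
    (parGraph r f).dist u v ≤ dep u + dep v := by
  obtain ⟨w, hw⟩ := parGraph_walk r f dep h _ u le_rfl
  obtain ⟨w', hw'⟩ := parGraph_walk r f dep h _ v le_rfl
  have := SimpleGraph.dist_le (w.append w'.reverse)
  simp at this
  omega

lemma parGraph_tree {V : Type*} [Fintype V] [DecidableEq V] (r : V) (f : V → V) (dep : V → ℕ)
    (h : ∀ q, q ≠ r → dep (f q) < dep q) : (parGraph r f).IsTree := by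
  classical
  have hc : (parGraph r f).Connected := by
    have : Nonempty V := ⟨r⟩
    refine SimpleGraph.Connected.mk ?_
    intro u v
    obtain ⟨w, hw⟩ := parGraph_walk r f dep h _ u le_rfl
    obtain ⟨w', hw'⟩ := parGraph_walk r f dep h _ v le_rfl
    exact ⟨w.append w'.reverse⟩
  rw [SimpleGraph.isTree_iff_connected_and_card]
  refine ⟨hc, ?_⟩
  have h1 := hc.card_vert_le_card_edgeSet_add_one
  have hsub : (parGraph r f).edgeSet ⊆
      ((Finset.univ.erase r).image (fun q => s(q, f q)) : Finset (Sym2 V)) := by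
    intro e he
    induction e using Sym2.ind with
    | _ a b =>
      rw [SimpleGraph.mem_edgeSet, parGraph_adj] at he
      simp only [Finset.coe_image, Set.mem_image, Finset.mem_coe, Finset.mem_erase,
        Finset.mem_univ, and_true]
      rcases he with ⟨_, ⟨ha, hf⟩ | ⟨hb, hf⟩⟩
      · exact ⟨a, ha, by rw [hf]⟩
      · exact ⟨b, hb, by rw [hf, Sym2.eq_swap]⟩
  have h2 : Nat.card (parGraph r f).edgeSet ≤ Fintype.card V - 1 := by
    have h3 := Set.ncard_le_ncard hsub (Finset.finite_toSet _)
    rw [Set.ncard_coe_finset] at h3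
    have h4 : ((Finset.univ.erase r).image (fun q => s(q, f q))).card ≤ _ :=
      Finset.card_image_le
    rw [Finset.card_erase_of_mem (Finset.mem_univ r), Finset.card_univ] at h4
    exact h3.trans h4
  have h5 : 0 < Fintype.card V := Fintype.card_pos_iff.mpr ⟨r⟩
  rw [← Nat.card_eq_fintype_card] at h2 h5
  omega

/-- The linear functional replacing the first coordinate. -/
def ph (e : ℝ) (p : Pt) : ℝ := p.1 + e * p.2

def vv (e s t : ℝ) (p : Pt) : ℝ := p.2 - s * ph e p - t

def cr3 (p q r : Pt) : ℝ := (q.1 - p.1) * (r.2 - p.2) - (q.2 - p.2) * (r.1 - p.1)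

lemma collinear_of_cr3 (p q r : Pt) (hpq : p ≠ q) (h : cr3 p q r = 0) :
    Collinear ℝ ({p, q, r} : Set Pt) := by
  rw [collinear_iff_of_mem (p₀ := p) (by simp)]
  refine ⟨q - p, ?_⟩
  have hD : (q.1 - p.1) ^ 2 + (q.2 - p.2) ^ 2 ≠ 0 := by
    intro h0
    have h1 : q.1 - p.1 = 0 := by nlinarith [sq_nonneg (q.1 - p.1), sq_nonneg (q.2 - p.2)]
    have h2 : q.2 - p.2 = 0 := by nlinarith [sq_nonneg (q.1 - p.1), sq_nonneg (q.2 - p.2)]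
    exact hpq (Prod.ext (by linarith) (by linarith))
  unfold cr3 at h
  intro x hx
  simp only [Set.mem_insert_iff, Set.mem_singleton_iff] at hx
  rcases hx with rfl | rfl | rfl
  · exact ⟨0, by simp⟩
  · exact ⟨1, by simp⟩
  · refine ⟨((q.1 - p.1) * (x.1 - p.1) + (q.2 - p.2) * (x.2 - p.2)) /
      ((q.1 - p.1) ^ 2 + (q.2 - p.2) ^ 2), ?_⟩
    apply Prod.ext
    · simp
      field_simp
      linear_combination (-(q.2 - p.2)) * h
    · simp
      field_simp
      linear_combination ((q.1 - p.1)) * h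

def GP (S : Finset Pt) : Prop :=
  ∀ p ∈ S, ∀ q ∈ S, ∀ r ∈ S, p ≠ q → p ≠ r → q ≠ r → cr3 p q r ≠ 0

lemma GenPos.gp {S : Finset Pt} (h : GenPos S) : GP S := by
  intro p hp q hq r hr h1 h2 h3 h0
  exact h p hp q hq r hr h1 h2 h3 (collinear_of_cr3 p q r h1 h0)

lemma GP.mono {S A : Finset Pt} (h : GP S) (hA : A ⊆ S) : GP A :=
  fun p hp q hq r hr => h p (hA hp) q (hA hq) r (hA hr)

lemma GP.on_line {S : Finset Pt} (h : GP S) (e s t : ℝ) :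
    (S.filter (fun p => vv e s t p = 0)).card ≤ 2 := by
  by_contra hc
  push Not at hc
  rw [Finset.two_lt_card] at hc
  obtain ⟨p, hp, q, hq, r, hr, h1, h2, h3⟩ := hc
  rw [Finset.mem_filter] at hp hq hr
  have := h p hp.1 q hq.1 r hr.1 h1 h2 h3
  apply this
  have e1 := hp.2
  have e2 := hq.2
  have e3 := hr.2
  unfold vv ph at e1 e2 e3
  unfold cr3
  by_cases hs : s = 0
  · subst hs
    have a1 : q.2 = p.2 := by linarith
    have a2 : r.2 = p.2 := by linarith
    rw [a1, a2]; ring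
  · apply mul_left_cancel₀ hs
    linear_combination (r.2 - p.2) * (e1 - e2) + (q.2 - p.2) * (e3 - e1)

/-- Affine functions on the plane. -/
def Aff (f : Pt → ℝ) : Prop :=
  ∀ (a b : ℝ) (p q : Pt), a + b = 1 → f (a • p + b • q) = a * f p + b * f q

lemma aff_ph (e : ℝ) : Aff (ph e) := by
  intro a b p q _
  simp [ph]; ring

lemma aff_vv (e s t : ℝ) : Aff (vv e s t) := by
  intro a b p q h
  simp [vv, ph]; linear_combination t * h

lemma disj_sep {f : Pt → ℝ} (hf : Aff f) (τ : ℝ) {p q p' q' : Pt} (h1 : f p < τ) (h2 : f q ≤ τ)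
    (h3 : τ ≤ f p') (h4 : τ ≤ f q') :
    openSegment ℝ q p ∩ openSegment ℝ q' p' = ∅ := by
  rw [Set.eq_empty_iff_forall_notMem]
  rintro z ⟨⟨a, b, ha, hb, hab, rfl⟩, ⟨c, d, hc, hd, hcd, he⟩⟩
  have e1 := hf a b q p hab
  have e2 := hf c d q' p' hcd
  rw [he] at e2
  have : a * f q + b * f p < τ := by
    have := mul_le_mul_of_nonneg_left h2 ha.le
    have := mul_lt_mul_of_pos_left h1 hb
    have : a * τ + b * τ = τ := by rw [← add_mul, hab, one_mul]
    linarith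
  have : τ ≤ c * f q' + d * f p' := by
    have := mul_le_mul_of_nonneg_left h4 hc.le
    have := mul_le_mul_of_nonneg_left h3 hd.le
    have : c * τ + d * τ = τ := by rw [← add_mul, hcd, one_mul]
    linarith
  linarith

lemma disj_share {p q q' : Pt} (h : cr3 p q q' ≠ 0) :
    openSegment ℝ q p ∩ openSegment ℝ q' p = ∅ := by
  rw [Set.eq_empty_iff_forall_notMem]
  rintro z ⟨⟨a, b, ha, hb, hab, rfl⟩, ⟨c, d, hc, hd, hcd, he⟩⟩
  apply h
  have e1 := congrArg Prod.fst he
  have e2 := congrArg Prod.snd he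
  simp at e1 e2
  unfold cr3
  apply mul_left_cancel₀ ha.ne'
  have hb' : b = 1 - a := by linarith
  have hd' : d = 1 - c := by linarith
  subst hb' hd'
  linear_combination (-(q'.2 - p.2)) * e1 + (q'.1 - p.1) * e2

/-- order statistics -/
lemma order_stat (F : Finset Pt) (b : ℕ) (hb : 1 ≤ b) (hbF : b ≤ F.card) (g : ℝ → Pt → ℝ)
    (hg : ∀ p, Continuous (fun s => g s p)) :
    ∃ T : ℝ → ℝ, Continuous T ∧ ∀ s, b ≤ (F.filter (fun p => T s ≤ g s p)).card ∧
      (F.filter (fun p => T s < g s p)).card < b ∧ ∃ p ∈ F, T s = g s p := by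
  classical
  have hne : (F.powersetCard b).Nonempty := Finset.powersetCard_nonempty.mpr hbF
  have hne2 : ∀ U : F.powersetCard b, U.1.Nonempty := by
    intro U
    have := (Finset.mem_powersetCard.mp U.2).2
    rw [← Finset.card_pos]; omega
  have hne3 : (F.powersetCard b).attach.Nonempty := by simpa using hne
  refine ⟨fun s => (F.powersetCard b).attach.sup' hne3 (fun U => U.1.inf' (hne2 U) (g s)), ?_, ?_⟩
  · apply Continuous.finset_sup'_apply
    intro U _
    apply Continuous.finset_inf'_apply
    intro p _
    exact hg p
  · intro s
    beta_reduce
    obtain ⟨U, -, hU⟩ := Finset.exists_mem_eq_sup' hne3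
      (fun U : F.powersetCard b => U.1.inf' (hne2 U) (g s))
    obtain ⟨hUF, hUc⟩ := Finset.mem_powersetCard.mp U.2
    refine ⟨?_, ?_, ?_⟩
    · rw [hU]
      refine hUc.symm.le.trans (Finset.card_le_card ?_)
      intro p hp
      rw [Finset.mem_filter]
      exact ⟨hUF hp, Finset.inf'_le _ hp⟩
    · by_contra hc
      push Not at hc
      obtain ⟨W, hW, hWc⟩ := Finset.exists_subset_card_eq hc
      have hWm : W ∈ F.powersetCard b :=
        Finset.mem_powersetCard.mpr ⟨hW.trans (Finset.filter_subset _ _), hWc⟩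
      have h1 := Finset.le_sup' (fun U : F.powersetCard b => U.1.inf' (hne2 U) (g s))
        (Finset.mem_attach _ ⟨W, hWm⟩)
      obtain ⟨p, hp, hpe⟩ := Finset.exists_mem_eq_inf' (hne2 ⟨W, hWm⟩) (g s)
      have h2 := (Finset.mem_filter.mp (hW hp)).2
      simp only at h1 h2
      rw [hpe] at h1
      linarith
    · obtain ⟨p, hp, hpe⟩ := Finset.exists_mem_eq_inf' (hne2 U) (g s)
      exact ⟨p, hUF hp, by rw [hU]; exact hpe⟩

lemma ham_sandwich (e : ℝ) (L R : Finset Pt) (hLR : ∀ p ∈ L, ∀ q ∈ R, ph e p < ph e q)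
    (a b : ℕ) (ha : 1 ≤ a) (haL : a ≤ L.card) (hb : 1 ≤ b) (hbR : b ≤ R.card) :
    ∃ s t : ℝ, a ≤ (L.filter (fun p => 0 ≤ vv e s t p)).card ∧
      (L.filter (fun p => 0 < vv e s t p)).card < a ∧
      b ≤ (R.filter (fun p => 0 ≤ vv e s t p)).card ∧
      (R.filter (fun p => 0 < vv e s t p)).card < b := by
  have hg : ∀ p : Pt, Continuous (fun s : ℝ => p.2 - s * ph e p) := by intro p; fun_prop
  obtain ⟨TL, cL, hL⟩ := order_stat L a ha haL (fun s p => p.2 - s * ph e p) hg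
  obtain ⟨TR, cR, hR⟩ := order_stat R b hb hbR (fun s p => p.2 - s * ph e p) hg
  have key1 : ∀ᶠ s : ℝ in Filter.atTop, ∀ p ∈ L, ∀ q ∈ R, q.2 - s * ph e q ≤ p.2 - s * ph e p := by
    rw [Filter.eventually_all_finset]
    intro p hp
    rw [Filter.eventually_all_finset]
    intro q hq
    filter_upwards [Filter.eventually_ge_atTop ((q.2 - p.2) / (ph e q - ph e p))] with s hs
    have h0 : 0 < ph e q - ph e p := by linarith [hLR p hp q hq]
    rw [div_le_iff₀ h0] at hs
    linarith
  have key2 : ∀ᶠ s : ℝ in Filter.atBot, ∀ p ∈ L, ∀ q ∈ R, p.2 - s * ph e p ≤ q.2 - s * ph e q := by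
    rw [Filter.eventually_all_finset]
    intro p hp
    rw [Filter.eventually_all_finset]
    intro q hq
    filter_upwards [Filter.eventually_le_atBot ((q.2 - p.2) / (ph e q - ph e p))] with s hs
    have h0 : 0 < ph e q - ph e p := by linarith [hLR p hp q hq]
    rw [le_div_iff₀ h0] at hs
    linarith
  obtain ⟨s1, h1⟩ := key1.exists
  obtain ⟨s2, h2⟩ := key2.exists
  have hc : Continuous (fun s => TL s - TR s) := cL.sub cR
  have h1' : 0 ≤ TL s1 - TR s1 := by
    obtain ⟨p, hp, hpe⟩ := (hL s1).2.2
    obtain ⟨q, hq, hqe⟩ := (hR s1).2.2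
    have := h1 p hp q hq
    linarith
  have h2' : TL s2 - TR s2 ≤ 0 := by
    obtain ⟨p, hp, hpe⟩ := (hL s2).2.2
    obtain ⟨q, hq, hqe⟩ := (hR s2).2.2
    have := h2 p hp q hq
    linarith
  obtain ⟨s, hs⟩ := mem_range_of_exists_le_of_exists_ge hc ⟨s2, h2'⟩ ⟨s1, h1'⟩
  have hs' : TL s = TR s := by simp only at hs; linarith
  refine ⟨s, TL s, ?_, ?_, ?_, ?_⟩
  · simpa [vv] using (hL s).1
  · simpa [vv] using (hL s).2.1
  · simpa [vv, hs'] using (hR s).1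
  · simpa [vv, hs'] using (hR s).2.1

/-- refined counts -/
lemma count_sides (e s t : ℝ) (S L : Finset Pt) (hS : GP S) (hL : L ⊆ S) (a : ℕ)
    (h1 : a ≤ (L.filter (fun p => 0 ≤ vv e s t p)).card)
    (h2 : (L.filter (fun p => 0 < vv e s t p)).card < a) :
    a ≤ (L.filter (fun p => 0 < vv e s t p)).card + 2 ∧
    (L.filter (fun p => 0 ≤ vv e s t p)).card ≤ a + 1 ∧
    (L.filter (fun p => 0 ≤ vv e s t p)).card + (L.filter (fun p => vv e s t p < 0)).card
      = L.card := by
  have h3 : (L.filter (fun p => vv e s t p = 0)).card ≤ 2 := (hS.mono hL).on_line e s t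
  have h4 : (L.filter (fun p => 0 ≤ vv e s t p)).card ≤
      (L.filter (fun p => 0 < vv e s t p)).card + (L.filter (fun p => vv e s t p = 0)).card := by
    rw [← Finset.card_union_of_disjoint]
    · apply Finset.card_le_card
      intro p hp
      simp only [Finset.mem_union, Finset.mem_filter] at hp ⊢
      rcases hp.2.lt_or_eq with h | h
      · exact Or.inl ⟨hp.1, h⟩
      · exact Or.inr ⟨hp.1, h.symm⟩
    · rw [Finset.disjoint_filter]
      intro p _ h h'
      linarith
  have h5 := Finset.card_filter_add_card_filter_not (s := L) (fun p => 0 ≤ vv e s t p)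
  simp only [not_le] at h5
  refine ⟨by omega, by omega, h5⟩

lemma exists_inj (F : Finset Pt) (k : ℕ) (h : k ≤ F.card) :
    ∃ g : Fin k → Pt, Function.Injective g ∧ ∀ i, g i ∈ F := by
  refine ⟨fun i => (F.equivFin.symm (Fin.castLE h i)).1, ?_, fun i => (F.equivFin.symm _).2⟩
  intro i j hij
  have := F.equivFin.symm.injective (Subtype.ext hij)
  exact Fin.castLE_injective h this

/-- The leftmost `m` points. -/
lemma exists_left (e : ℝ) (A : Finset Pt) (hinj : Set.InjOn (ph e) A) (m : ℕ) (h : m ≤ A.card) :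
    ∃ G ⊆ A, G.card = m ∧ ∀ p ∈ G, ∀ q ∈ A \ G, ph e p < ph e q := by
  classical
  induction m with
  | zero => exact ⟨∅, by simp, by simp, by simp⟩
  | succ m ih =>
    obtain ⟨G, hG, hc, hlt⟩ := ih (by omega)
    have hne : (A \ G).Nonempty := by
      rw [← Finset.card_pos, Finset.card_sdiff_of_subset hG]; omega
    obtain ⟨x, hx, hmin⟩ := Finset.exists_min_image (A \ G) (ph e) hne
    rw [Finset.mem_sdiff] at hx
    refine ⟨insert x G, ?_, ?_, ?_⟩
    · intro y hy
      rw [Finset.mem_insert] at hy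
      rcases hy with rfl | hy
      · exact hx.1
      · exact hG hy
    · rw [Finset.card_insert_of_notMem hx.2, hc]
    · intro p hp q hq
      simp only [Finset.mem_sdiff, Finset.mem_insert, not_or] at hq
      have hq' : q ∈ A \ G := Finset.mem_sdiff.mpr ⟨hq.1, hq.2.2⟩
      rw [Finset.mem_insert] at hp
      rcases hp with rfl | hp
      · refine lt_of_le_of_ne (hmin q hq') ?_
        intro he
        exact hq.2.1 (hinj hx.1 hq.1 he).symm
      · exact hlt p hp q hq'

/-- a generic direction -/
lemma exists_dir (S : Finset Pt) : ∃ e : ℝ, Set.InjOn (ph e) S := by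
  classical
  let bad : Finset ℝ := (S ×ˢ S).image (fun x => (x.2.1 - x.1.1) / (x.1.2 - x.2.2))
  obtain ⟨e, he⟩ := Infinite.exists_notMem_finset bad
  refine ⟨e, ?_⟩
  intro p hp q hq hpq
  unfold ph at hpq
  by_cases h2 : p.2 = q.2
  · rw [h2] at hpq
    exact Prod.ext (by linarith) h2
  · exfalso
    apply he
    rw [Finset.mem_image]
    refine ⟨(p, q), Finset.mem_product.mpr ⟨hp, hq⟩, ?_⟩
    have : p.2 - q.2 ≠ 0 := sub_ne_zero.mpr h2
    simp only
    rw [div_eq_iff this]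
    linarith

end helpers

section recursion

/-- Output of the recursive construction: for every label `i` a parent function on `A`,
where the points of the initial segment `N i` are to be attached from outside. -/
structure Rec (e : ℝ) (k s d : ℕ) (A : Finset Pt) (par : Fin k → Pt → Pt)
    (N : Fin k → Finset Pt) (dep : Fin k → Pt → ℕ) : Prop where
  Nsub : ∀ i, N i ⊆ A
  Ncard : ∀ i, (N i).card ≤ s
  par_mem : ∀ i, ∀ q ∈ A, q ∉ N i → par i q ∈ A
  par_lt : ∀ i, ∀ q ∈ A, q ∉ N i → ph e (par i q) < ph e q
  disj : ∀ i j, ∀ q ∈ A, q ∉ N i → q ∉ N j → par i q = par j q → i = j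
  head : ∀ i, ∀ q ∈ N i, ∀ q' ∈ A, q' ∉ N i → ph e q ≤ ph e (par i q')
  plane : ∀ i, ∀ q ∈ A, q ∉ N i → ∀ q' ∈ A, q' ∉ N i → q ≠ q' →
    openSegment ℝ q (par i q) ∩ openSegment ℝ q' (par i q') = ∅
  deg : ∀ i p, (A.filter (fun q => q ∉ N i ∧ par i q = p)).card ≤ 3 * s
  dep_le : ∀ i, ∀ q ∈ A, dep i q ≤ 2 * d
  dep_lt : ∀ i, ∀ q ∈ A, q ∉ N i → dep i (par i q) < dep i q

lemma rec_small (e : ℝ) (k s d : ℕ) (A : Finset Pt) (h : A.card ≤ s) :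
    Rec e k s d A (fun _ q => q) (fun _ => A) (fun _ _ => 0) where
  Nsub _ := Finset.Subset.refl _
  Ncard _ := h
  par_mem _ q hq hn := absurd hq hn
  par_lt _ q hq hn := absurd hq hn
  disj _ _ q hq hn := absurd hq hn
  head _ _ _ q hq hn := absurd hq hn
  plane _ q hq hn := absurd hq hn
  deg i p := by
    rw [Finset.filter_false_of_mem]
    · simp
    · intro q hq h; exact h.1 hq
  dep_le _ _ _ := Nat.zero_le _
  dep_lt _ q hq hn := absurd hq hn

lemma rec_exists (e : ℝ) (k s : ℕ) (hk : 1 ≤ k) (hs : 2 * k + 4 ≤ s) :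
    ∀ (d : ℕ) (A : Finset Pt), GP A → Set.InjOn (ph e) A → A.card ≤ s * 2 ^ d →
      ∃ par N dep, Rec e k s d A par N dep := by
  classical
  intro d
  induction d with
  | zero =>
    intro A _ _ hA
    exact ⟨_, _, _, rec_small e k s 0 A (by simpa using hA)⟩
  | succ d ih =>
    intro A hgp hinj hA
    by_cases hsm : A.card ≤ s
    · exact ⟨_, _, _, rec_small e k s (d + 1) A hsm⟩
    push Not at hsm
    obtain ⟨G, hGA, hGc, hlt⟩ := exists_left e A hinj (2 * k + 3) (by omega)
    have hA'c := Finset.card_sdiff_of_subset hGA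
    obtain ⟨σ, t, hL1, hL2, hR1, hR2⟩ := ham_sandwich e G (A \ G) hlt (k + 2)
      (((A \ G).card + 1) / 2) (by omega) (by omega) (by omega) (by omega)
    obtain ⟨hL3, hL4, hL5⟩ := count_sides e σ t A G hgp hGA _ hL1 hL2
    obtain ⟨hR3, hR4, hR5⟩ := count_sides e σ t A (A \ G) hgp Finset.sdiff_subset _ hR1 hR2
    set sd : Pt → Bool := fun q => decide (0 ≤ vv e σ t q) with hsd
    have hsdt : ∀ q, sd q = true ↔ 0 ≤ vv e σ t q := by intro q; simp [hsd]
    have hsdf : ∀ q, sd q = false ↔ vv e σ t q < 0 := by intro q; simp [hsd]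
    -- separation by the two sides
    have hside : ∀ p q p' q' : Pt, sd p = sd q → sd p' = sd q' → sd q ≠ sd q' →
        openSegment ℝ q p ∩ openSegment ℝ q' p' = ∅ := by
      intro p q p' q' h1 h2 h3
      cases h : sd q with
      | false =>
        have h' : sd q' = true := by
          cases h'' : sd q' with
          | false => rw [h, h''] at h3; exact absurd rfl h3
          | true => rfl
        rw [h] at h1
        rw [h'] at h2
        rw [hsdf] at h h1
        rw [hsdt] at h' h2
        exact disj_sep (aff_vv e σ t) 0 h1 h.le h2 h'
      | true =>
        have h' : sd q' = false := by
          cases h'' : sd q' with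
          | true => rw [h, h''] at h3; exact absurd rfl h3
          | false => rfl
        rw [h] at h1
        rw [h'] at h2
        rw [hsdt] at h h1
        rw [hsdf] at h' h2
        rw [Set.inter_comm]
        exact disj_sep (aff_vv e σ t) 0 h2 h'.le h1 h
    have hub : ∀ c : Bool, ∃ g : Fin k → Pt, Function.Injective g ∧
        ∀ i, g i ∈ G ∧ sd (g i) = c := by
      intro c
      have hcard : k ≤ (G.filter (fun q => sd q = c)).card := by
        cases c with
        | true => simp only [hsdt]; omega
        | false => simp only [hsdf]; omega
      obtain ⟨g, hg1, hg2⟩ := exists_inj _ k hcard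
      exact ⟨g, hg1, fun i => by simpa using hg2 i⟩
    choose a ainj ha using hub
    set B : Bool → Finset Pt := fun c => (A \ G).filter (fun q => sd q = c) with hB
    have hBmem : ∀ c q, q ∈ B c ↔ (q ∈ A ∧ q ∉ G) ∧ sd q = c := by
      intro c q; simp [hB]
    have hBA : ∀ c, B c ⊆ A := fun c q hq => ((hBmem c q).1 hq).1.1
    have hBcard : ∀ c, (B c).card ≤ s * 2 ^ d := by
      intro c
      have h2 : s * 2 ^ (d + 1) = 2 * (s * 2 ^ d) := by ring
      rw [h2] at hA
      cases c with
      | true => simp only [hB, hsdt]; omega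
      | false => simp only [hB, hsdf]; omega
    have hrec : ∀ c, ∃ par N dep, Rec e k s d (B c) par N dep := fun c =>
      ih (B c) (hgp.mono (hBA c)) (hinj.mono (by exact_mod_cast hBA c)) (hBcard c)
    choose parB NB depB hR using hrec
    have hfl : ∀ i, ∃ f l : Pt, ph e f ≤ ph e l ∧ (∃ c, f = a c i) ∧ (∃ c, l = a c i) ∧
        ∀ c, a c i = f ∨ a c i = l := by
      intro i
      rcases le_total (ph e (a true i)) (ph e (a false i)) with h | h
      · refine ⟨_, _, h, ⟨_, rfl⟩, ⟨_, rfl⟩, ?_⟩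
        intro c; cases c <;> simp
      · refine ⟨_, _, h, ⟨_, rfl⟩, ⟨_, rfl⟩, ?_⟩
        intro c; cases c <;> simp
    choose f l hfl1 hf hl hfl2 using hfl
    have hfG : ∀ i, f i ∈ G := by
      intro i; obtain ⟨c, hc⟩ := hf i; rw [hc]; exact (ha c i).1
    have hlG : ∀ i, l i ∈ G := by
      intro i; obtain ⟨c, hc⟩ := hl i; rw [hc]; exact (ha c i).1
    have hal : ∀ c i, ph e (a c i) ≤ ph e (l i) := by
      intro c i
      rcases hfl2 i c with h | h
      · rw [h]; exact hfl1 i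
      · rw [h]
    have hfa : ∀ c i, ph e (f i) ≤ ph e (a c i) := by
      intro c i
      rcases hfl2 i c with h | h
      · rw [h]
      · rw [h]; exact hfl1 i
    have hGB : ∀ c, ∀ p ∈ G, ∀ q ∈ B c, ph e p < ph e q := by
      intro c p hp q hq
      have := (hBmem c q).1 hq
      exact hlt p hp q (Finset.mem_sdiff.mpr this.1)
    set N : Fin k → Finset Pt := fun i => A.filter (fun q => ph e q ≤ ph e (f i)) with hN
    have hNmem : ∀ i q, q ∈ N i ↔ q ∈ A ∧ ph e q ≤ ph e (f i) := by intro i q; simp [hN]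
    have hNG : ∀ i, N i ⊆ G := by
      intro i q hq
      rw [hNmem] at hq
      by_contra hqG
      have := hlt (f i) (hfG i) q (Finset.mem_sdiff.mpr ⟨hq.1, hqG⟩)
      linarith [hq.2]
    set par : Fin k → Pt → Pt := fun i q => if ph e q ≤ ph e (l i) then f i
      else if q ∈ B (sd q) ∧ q ∉ NB (sd q) i then parB (sd q) i q else a (sd q) i with hpar
    set dep : Fin k → Pt → ℕ := fun i q => if ph e q ≤ ph e (f i) then 0
      else if ph e q ≤ ph e (l i) then 1 else if q ∈ G then 2 else depB (sd q) i q + 2 with hdep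
    have spec : ∀ i, ∀ q ∈ A, q ∉ N i → ph e (f i) < ph e q ∧
        ((ph e q ≤ ph e (l i) ∧ q ∈ G ∧ par i q = f i) ∨
         (ph e (l i) < ph e q ∧ (q ∈ G ∨ q ∈ NB (sd q) i) ∧ par i q = a (sd q) i) ∨
         (ph e (l i) < ph e q ∧ q ∈ B (sd q) ∧ q ∉ NB (sd q) i ∧
           par i q = parB (sd q) i q)) := by
      intro i q hq hqN
      have h1 : ph e (f i) < ph e q := by
        by_contra h; push Not at h; exact hqN ((hNmem i q).2 ⟨hq, h⟩)
      refine ⟨h1, ?_⟩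
      by_cases h2 : ph e q ≤ ph e (l i)
      · left
        refine ⟨h2, ?_, by simp [hpar, h2]⟩
        by_contra hqG
        have := hlt (l i) (hlG i) q (Finset.mem_sdiff.mpr ⟨hq, hqG⟩)
        linarith
      · right
        by_cases h3 : q ∈ B (sd q) ∧ q ∉ NB (sd q) i
        · right
          refine ⟨not_le.mp h2, h3.1, h3.2, ?_⟩
          simp only [hpar]
          rw [if_neg h2, if_pos h3]
        · left
          refine ⟨not_le.mp h2, ?_, ?_⟩
          · by_cases hqG : q ∈ G
            · exact Or.inl hqG
            · right
              by_contra h4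
              exact h3 ⟨(hBmem _ _).2 ⟨⟨hq, hqG⟩, rfl⟩, h4⟩
          · simp only [hpar]
            rw [if_neg h2, if_neg h3]
    -- parents of the third type
    have hp4 : ∀ i q, q ∈ B (sd q) → q ∉ NB (sd q) i →
        parB (sd q) i q ∈ B (sd q) := fun i q h1 h2 => (hR (sd q)).par_mem i q h1 h2
    have hp4s : ∀ i q, q ∈ B (sd q) → q ∉ NB (sd q) i →
        sd (parB (sd q) i q) = sd q := fun i q h1 h2 => ((hBmem _ _).1 (hp4 i q h1 h2)).2
    have par_mem : ∀ i, ∀ q ∈ A, q ∉ N i → par i q ∈ A := by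
      intro i q hq hqN
      rcases (spec i q hq hqN).2 with ⟨_, _, h⟩ | ⟨_, _, h⟩ | ⟨_, h1, h2, h⟩ <;> rw [h]
      · exact hGA (hfG i)
      · exact hGA (ha _ i).1
      · exact hBA _ (hp4 i q h1 h2)
    have par_lt : ∀ i, ∀ q ∈ A, q ∉ N i → ph e (par i q) < ph e q := by
      intro i q hq hqN
      obtain ⟨h0, ⟨_, _, h⟩ | ⟨h1, _, h⟩ | ⟨_, h1, h2, h⟩⟩ := spec i q hq hqN <;> rw [h]
      · exact h0
      · exact lt_of_le_of_lt (hal _ i) h1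
      · exact (hR (sd q)).par_lt i q h1 h2
    have par_ge : ∀ i, ∀ q ∈ A, q ∉ N i → ph e (f i) ≤ ph e (par i q) := by
      intro i q hq hqN
      obtain ⟨h0, ⟨_, _, h⟩ | ⟨h1, _, h⟩ | ⟨_, h1, h2, h⟩⟩ := spec i q hq hqN <;> rw [h]
      · exact hfa _ i
      · exact (hGB _ _ (hfG i) _ (hp4 i q h1 h2)).le
    -- both orders for the planarity
    have share : ∀ p q q' : Pt, p ∈ A → q ∈ A → q' ∈ A → p ≠ q → p ≠ q' → q ≠ q' →
        openSegment ℝ q p ∩ openSegment ℝ q' p = ∅ := fun p q q' hp hq hq' h1 h2 h3 =>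
      disj_share (hgp p hp q hq q' hq' h1 h2 h3)
    have sepφ : ∀ p q p' q' : Pt, ph e p < ph e q → ph e q ≤ ph e p' → ph e p' < ph e q' →
        openSegment ℝ q p ∩ openSegment ℝ q' p' = ∅ := fun p q p' q' h1 h2 h3 =>
      disj_sep (aff_ph e) (ph e q) h1 le_rfl h2 (h2.trans h3.le)
    -- planarity, with the index of the type of the first edge at most that of the second
    have pl12 : ∀ i, ∀ q ∈ A, q ∉ N i → ∀ q' ∈ A, q' ∉ N i → q ≠ q' →
        (ph e q ≤ ph e (l i) ∧ par i q = f i) →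
        openSegment ℝ q (par i q) ∩ openSegment ℝ q' (par i q') = ∅ := by
      intro i q hq hqN q' hq' hqN' hne ⟨h1, h2⟩
      have hlt1 := par_lt i q hq hqN
      have hlt2 := par_lt i q' hq' hqN'
      by_cases hpp : par i q' = par i q
      · rw [hpp] at hlt2 ⊢
        refine share _ q q' (par_mem i q hq hqN) hq hq' ?_ ?_ hne
        · intro h; rw [h] at hlt1; exact lt_irrefl _ hlt1
        · intro h; rw [h] at hlt2; exact lt_irrefl _ hlt2
      · apply sepφ _ _ _ _ hlt1 _ hlt2
        obtain ⟨h0', ⟨_, _, h⟩ | ⟨h1', _, h⟩ | ⟨_, h1', h2', h⟩⟩ := spec i q' hq' hqN'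
        · rw [h, h2] at hpp; exact absurd rfl hpp
        · rcases hfl2 i (sd q') with h3 | h3
          · rw [h, h2, h3] at hpp; exact absurd rfl hpp
          · rw [h, h3]; exact h1
        · rw [h]
          exact h1.trans (hGB _ _ (hlG i) _ (hp4 i q' h1' h2')).le
    have pl23 : ∀ i, ∀ q ∈ A, q ∉ N i → ∀ q' ∈ A, q' ∉ N i → q ≠ q' →
        ((q ∈ G ∨ q ∈ NB (sd q) i) ∧ par i q = a (sd q) i) →
        ((q' ∈ B (sd q') ∧ q' ∉ NB (sd q') i ∧ par i q' = parB (sd q') i q')) →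
        openSegment ℝ q (par i q) ∩ openSegment ℝ q' (par i q') = ∅ := by
      intro i q hq hqN q' hq' hqN' hne ⟨h1, h2⟩ ⟨h3, h4, h5⟩
      have hlt1 := par_lt i q hq hqN
      have hlt2 := par_lt i q' hq' hqN'
      by_cases hss : sd q = sd q'
      · apply sepφ _ _ _ _ hlt1 _ hlt2
        rw [h5]
        rcases h1 with h1 | h1
        · exact (hGB _ _ h1 _ (hp4 i q' h3 h4)).le
        · rw [hss] at h1
          exact (hR (sd q')).head i q h1 q' h3 h4
      · apply hside
        · rw [h2]; exact (ha _ i).2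
        · rw [h5]; exact hp4s i q' h3 h4
        · exact hss
    refine ⟨par, N, dep, ?_⟩
    refine ⟨fun i => (hNG i).trans hGA, ?_, par_mem, par_lt, ?_, ?_, ?_, ?_, ?_, ?_⟩
    · intro i
      have := Finset.card_le_card (hNG i)
      omega
    · -- disj
      have hubeq : ∀ c c' i j, a c i = a c' j → i = j := by
        intro c c' i j h
        have h1 := (ha c i).2
        rw [h, (ha c' j).2] at h1
        subst h1
        exact ainj _ h
      -- parent in G is a hub, parent in A \ G comes from the recursion
      have spec2 : ∀ i, ∀ q ∈ A, q ∉ N i → (par i q ∈ G ∧ ∃ c, par i q = a c i) ∨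
          (par i q ∉ G ∧ q ∈ B (sd q) ∧ q ∉ NB (sd q) i ∧ par i q = parB (sd q) i q) := by
        intro i q hq hqN
        obtain ⟨h0, ⟨_, _, h⟩ | ⟨h1, _, h⟩ | ⟨_, h1, h2, h⟩⟩ := spec i q hq hqN
        · left; rw [h]; exact ⟨hfG i, hf i⟩
        · left; rw [h]; exact ⟨(ha _ i).1, _, rfl⟩
        · right
          refine ⟨?_, h1, h2, h⟩
          rw [h]
          exact ((hBmem _ _).1 (hp4 i q h1 h2)).1.2
      intro i j q hq hqi hqj hpe
      rcases spec2 i q hq hqi with ⟨h1, c, h2⟩ | ⟨h1, h2, h3, h4⟩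
      · rcases spec2 j q hq hqj with ⟨h1', c', h2'⟩ | ⟨h1', _⟩
        · rw [h2, h2'] at hpe
          exact hubeq _ _ _ _ hpe
        · rw [← hpe] at h1'; exact absurd h1 h1'
      · rcases spec2 j q hq hqj with ⟨h1', c', h2'⟩ | ⟨h1', h2', h3', h4'⟩
        · rw [hpe] at h1; exact absurd h1' h1
        · rw [h4, h4'] at hpe
          exact (hR (sd q)).disj i j q h2 h3 h3' hpe
    · -- head
      intro i q hq q' hq' hqN'
      rw [hNmem] at hq
      exact hq.2.trans (par_ge i q' hq' hqN')
    · -- plane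
      intro i q hq hqN q' hq' hqN' hne
      obtain ⟨h0, ⟨h1, _, h⟩ | ⟨h1, h2, h⟩ | ⟨_, h1, h2, h⟩⟩ := spec i q hq hqN
      · exact pl12 i q hq hqN q' hq' hqN' hne ⟨h1, h⟩
      · obtain ⟨h0', ⟨h1', _, h'⟩ | ⟨h1', h2', h'⟩ | ⟨_, h1', h2', h'⟩⟩ := spec i q' hq' hqN'
        · rw [Set.inter_comm]
          exact pl12 i q' hq' hqN' q hq hqN hne.symm ⟨h1', h'⟩
        · have hlt1 := par_lt i q hq hqN
          have hlt2 := par_lt i q' hq' hqN'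
          by_cases hss : sd q = sd q'
          · have hpp : par i q' = par i q := by rw [h, h', hss]
            rw [hpp] at hlt2 ⊢
            refine share _ q q' (par_mem i q hq hqN) hq hq' ?_ ?_ hne
            · intro h; rw [h] at hlt1; exact lt_irrefl _ hlt1
            · intro h; rw [h] at hlt2; exact lt_irrefl _ hlt2
          · apply hside
            · rw [h]; exact (ha _ i).2
            · rw [h']; exact (ha _ i).2
            · exact hss
        · exact pl23 i q hq hqN q' hq' hqN' hne ⟨h2, h⟩ ⟨h1', h2', h'⟩
      · obtain ⟨h0', ⟨h1', _, h'⟩ | ⟨_, h2', h'⟩ | ⟨_, h1', h2', h'⟩⟩ := spec i q' hq' hqN'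
        · rw [Set.inter_comm]
          exact pl12 i q' hq' hqN' q hq hqN hne.symm ⟨h1', h'⟩
        · rw [Set.inter_comm]
          exact pl23 i q' hq' hqN' q hq hqN hne.symm ⟨h2', h'⟩ ⟨h1, h2, h⟩
        · by_cases hss : sd q = sd q'
          · rw [h, h']
            rw [hss] at h1 h2 ⊢
            exact (hR (sd q')).plane i q h1 h2 q' h1' h2' hne
          · apply hside
            · rw [h]; exact hp4s i q h1 h2
            · rw [h']; exact hp4s i q' h1' h2'
            · exact hss
    · -- deg
      intro i p
      by_cases hp : p ∈ B (sd p)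
      · refine le_trans (Finset.card_le_card ?_) ((hR (sd p)).deg i p)
        intro q hq
        rw [Finset.mem_filter] at hq ⊢
        obtain ⟨hqA, hqN, hqp⟩ := hq
        have hpG : p ∉ G := ((hBmem _ _).1 hp).1.2
        obtain ⟨h0, ⟨h1, _, h⟩ | ⟨h1, h2, h⟩ | ⟨_, h1, h2, h⟩⟩ := spec i q hqA hqN
        · rw [hqp] at h; rw [h] at hpG; exact absurd (hfG i) hpG
        · rw [hqp] at h; rw [h] at hpG; exact absurd (ha _ i).1 hpG
        · have hss := hp4s i q h1 h2
          rw [← h, hqp] at hss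
          rw [hss]
          exact ⟨h1, h2, by rw [← h]; exact hqp⟩
      · have hsub : A.filter (fun q => q ∉ N i ∧ par i q = p) ⊆
            G ∪ (NB true i ∪ NB false i) := by
          intro q hq
          rw [Finset.mem_filter] at hq
          obtain ⟨hqA, hqN, hqp⟩ := hq
          simp only [Finset.mem_union]
          obtain ⟨h0, ⟨h1, hG, h⟩ | ⟨h1, h2, h⟩ | ⟨_, h1, h2, h⟩⟩ := spec i q hqA hqN
          · exact Or.inl hG
          · rcases h2 with h2 | h2
            · exact Or.inl h2
            · right
              cases hc : sd q with
              | true => rw [hc] at h2; exact Or.inl h2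
              | false => rw [hc] at h2; exact Or.inr h2
          · exfalso
            apply hp
            have hss := hp4s i q h1 h2
            have := hp4 i q h1 h2
            rw [← h, hqp] at hss this
            rw [hss]; exact this
        have h1 := Finset.card_le_card hsub
        have h2 := Finset.card_union_le G (NB true i ∪ NB false i)
        have h3 := Finset.card_union_le (NB true i) (NB false i)
        have h4 := (hR true).Ncard i
        have h5 := (hR false).Ncard i
        omega
    · -- dep_le
      intro i q hq
      simp only [hdep]
      split_ifs with h1 h2 h3
      · omega
      · omega
      · omega
      · have := (hR (sd q)).dep_le i q ((hBmem _ _).2 ⟨⟨hq, h3⟩, rfl⟩)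
        omega
    · -- dep_lt
      intro i q hq hqN
      obtain ⟨h0, ⟨h1, hG, h⟩ | ⟨h1, h2, h⟩ | ⟨h0', h1, h2, h⟩⟩ := spec i q hq hqN
      · rw [h]
        have e1 : dep i (f i) = 0 := by simp [hdep]
        have e2 : dep i q = 1 := by simp [hdep, h1, h0]
        omega
      · rw [h]
        have e1 : dep i (a (sd q) i) ≤ 1 := by
          simp only [hdep]
          split_ifs with h3 h4
          · omega
          · omega
          · exact absurd (hal _ i) h4
          · exact absurd (hal _ i) h4
        have e2 : 2 ≤ dep i q := by
          simp only [hdep]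
          rw [if_neg (not_le.mpr h0), if_neg (not_le.mpr h1)]
          split_ifs <;> omega
        omega
      · rw [h]
        have hpB := hp4 i q h1 h2
        have hps := hp4s i q h1 h2
        have hd := (hR (sd q)).dep_lt i q h1 h2
        have e1 : dep i (parB (sd q) i q) = depB (sd q) i (parB (sd q) i q) + 2 := by
          have g1 := hGB _ _ (hfG i) _ hpB
          have g2 := hGB _ _ (hlG i) _ hpB
          have g3 := ((hBmem _ _).1 hpB).1.2
          simp only [hdep]
          rw [if_neg (not_le.mpr g1), if_neg (not_le.mpr g2), if_neg g3, hps]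
        have e2 : dep i q = depB (sd q) i q + 2 := by
          have g3 := ((hBmem _ _).1 h1).1.2
          simp only [hdep]
          rw [if_neg (not_le.mpr h0), if_neg (not_le.mpr h0'), if_neg g3]
        omega

end recursion

section rootpart

/-- cross product in the coordinates `u`, `v`. -/
def crs (u v : Pt → ℝ) (p q : Pt) : ℝ := u p * v q - v p * u q

/-- One point in each of the four quadrants, counterclockwise. -/
structure Quad (u v : Pt → ℝ) (h : Fin 4 → Pt) : Prop where
  u0 : 0 < u (h 0)
  v0 : 0 < v (h 0)
  u1 : u (h 1) < 0
  v1 : 0 < v (h 1)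
  u2 : u (h 2) < 0
  v2 : v (h 2) < 0
  u3 : 0 < u (h 3)
  v3 : v (h 3) < 0

lemma Quad.step {u v : Pt → ℝ} {h : Fin 4 → Pt} (H : Quad u v h) (s : Fin 4) :
    0 < crs u v (h s) (h (s + 1)) := by
  obtain ⟨u0, v0, u1, v1, u2, v2, u3, v3⟩ := H
  unfold crs
  fin_cases s
  · change 0 < u (h 0) * v (h 1) - v (h 0) * u (h 1)
    nlinarith [mul_pos u0 v1, mul_pos_of_neg_of_neg u1 (neg_lt_zero.mpr v0)]
  · change 0 < u (h 1) * v (h 2) - v (h 1) * u (h 2)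
    nlinarith [mul_pos_of_neg_of_neg u1 v2, mul_pos_of_neg_of_neg u2 (neg_lt_zero.mpr v1)]
  · change 0 < u (h 2) * v (h 3) - v (h 2) * u (h 3)
    nlinarith [mul_pos_of_neg_of_neg u2 v3, mul_pos_of_neg_of_neg v2 (neg_lt_zero.mpr u3)]
  · change 0 < u (h 3) * v (h 0) - v (h 3) * u (h 0)
    nlinarith [mul_pos u3 v0, mul_pos_of_neg_of_neg v3 (neg_lt_zero.mpr u0)]

lemma crs_swap (u v : Pt → ℝ) (p q : Pt) : crs u v p q = - crs u v q p := by
  unfold crs; ring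

lemma Quad.cover {u v : Pt → ℝ} {h : Fin 4 → Pt} (H : Quad u v h) (q : Pt)
    (hq : u q ≠ 0) : ∃ s : Fin 4, 0 ≤ crs u v (h s) q ∧ 0 < crs u v q (h (s + 1)) := by
  by_contra hc
  push Not at hc
  have hstep : ∀ s : Fin 4, 0 ≤ crs u v (h s) q → 0 ≤ crs u v (h (s + 1)) q := by
    intro s hs
    have := hc s hs
    rw [crs_swap] at this
    linarith
  have s01 := hstep 0
  have s12 := hstep 1
  have s23 := hstep 2
  have s30 := hstep 3
  simp only [show (0 : Fin 4) + 1 = 1 from rfl, show (1 : Fin 4) + 1 = 2 from rfl,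
    show (2 : Fin 4) + 1 = 3 from rfl, show (3 : Fin 4) + 1 = 0 from rfl] at s01 s12 s23 s30
  obtain ⟨u0, v0, u1, v1, u2, v2, u3, v3⟩ := H
  -- some hub has negative cross product, some hub has positive one
  have hneg : ∃ s : Fin 4, crs u v (h s) q < 0 := by
    unfold crs
    rcases lt_or_gt_of_ne hq with hu | hu <;> rcases le_total 0 (v q) with hv | hv
    · exact ⟨2, by nlinarith [mul_pos_of_neg_of_neg v2 hu]⟩
    · exact ⟨3, by nlinarith [mul_pos_of_neg_of_neg v3 hu]⟩
    · exact ⟨1, by nlinarith [mul_pos v1 hu]⟩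
    · exact ⟨0, by nlinarith [mul_pos v0 hu]⟩
  have hpos : ∃ s : Fin 4, 0 < crs u v (h s) q := by
    unfold crs
    rcases lt_or_gt_of_ne hq with hu | hu <;> rcases le_total 0 (v q) with hv | hv
    · exact ⟨0, by nlinarith [mul_neg_of_pos_of_neg v0 hu, mul_nonneg u0.le hv]⟩
    · exact ⟨1, by nlinarith [mul_neg_of_pos_of_neg v1 hu, mul_nonneg_of_nonpos_of_nonpos u1.le hv]⟩
    · exact ⟨3, by nlinarith [mul_neg_of_neg_of_pos v3 hu, mul_nonneg u3.le hv]⟩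
    · exact ⟨2, by nlinarith [mul_neg_of_neg_of_pos v2 hu, mul_nonneg_of_nonpos_of_nonpos u2.le hv]⟩
  obtain ⟨s, hs⟩ := hneg
  obtain ⟨t, ht⟩ := hpos
  have hall : 0 ≤ crs u v (h 0) q ∧ 0 ≤ crs u v (h 1) q ∧ 0 ≤ crs u v (h 2) q ∧
      0 ≤ crs u v (h 3) q := by
    have ht' := ht.le
    fin_cases t
    · have h1 := s01 ht'; have h2 := s12 h1; exact ⟨ht', h1, h2, s23 h2⟩
    · have h2 := s12 ht'; have h3 := s23 h2; exact ⟨s30 h3, ht', h2, h3⟩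
    · have h3 := s23 ht'; have h0 := s30 h3; exact ⟨h0, s01 h0, ht', h3⟩
    · have h0 := s30 ht'; have h1 := s01 h0; exact ⟨h0, h1, s12 h1, ht'⟩
  obtain ⟨a0, a1, a2, a3⟩ := hall
  fin_cases s
  · exact absurd hs (not_lt.mpr a0)
  · exact absurd hs (not_lt.mpr a1)
  · exact absurd hs (not_lt.mpr a2)
  · exact absurd hs (not_lt.mpr a3)

lemma Quad.cone_disj {u v : Pt → ℝ} {h : Fin 4 → Pt} (H : Quad u v h) (z : Pt) (s t : Fin 4)
    (hst : s ≠ t) (h1 : 0 ≤ crs u v (h s) z) (h2 : 0 < crs u v z (h (s + 1)))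
    (h3 : 0 ≤ crs u v (h t) z) (h4 : 0 < crs u v z (h (t + 1))) : False := by
  have adj : ∀ s : Fin 4, 0 < crs u v z (h (s + 1)) → 0 ≤ crs u v (h (s + 1)) z → False := by
    intro s ha hb
    rw [crs_swap] at ha
    linarith
  have cv : ∀ s, 0 ≤ crs u v (h s) z → 0 < crs u v z (h (s + 1)) → 
      (0 < v (h s) → 0 < v (h (s + 1)) → 0 < v z) ∧ (v (h s) < 0 → v (h (s + 1)) < 0 → v z < 0) ∧
      (0 < u (h s) → 0 < u (h (s + 1)) → 0 < u z) ∧ (u (h s) < 0 → u (h (s + 1)) < 0 → u z < 0) := by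
    intro s ha hb
    have hs := H.step s
    have e1 : crs u v (h s) (h (s + 1)) * v z =
        v (h s) * crs u v z (h (s + 1)) + v (h (s + 1)) * crs u v (h s) z := by
      unfold crs; ring
    have e2 : crs u v (h s) (h (s + 1)) * u z =
        u (h s) * crs u v z (h (s + 1)) + u (h (s + 1)) * crs u v (h s) z := by
      unfold crs; ring
    refine ⟨?_, ?_, ?_, ?_⟩
    · intro x y
      have := mul_pos x hb
      have := mul_nonneg y.le ha
      exact pos_of_mul_pos_right (by linarith : 0 < crs u v (h s) (h (s + 1)) * v z) hs.le
    · intro x y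
      have := mul_neg_of_neg_of_pos x hb
      have := mul_nonpos_of_nonpos_of_nonneg y.le ha
      by_contra hz
      have := mul_nonneg hs.le (not_lt.mp hz)
      linarith
    · intro x y
      have := mul_pos x hb
      have := mul_nonneg y.le ha
      exact pos_of_mul_pos_right (by linarith : 0 < crs u v (h s) (h (s + 1)) * u z) hs.le
    · intro x y
      have := mul_neg_of_neg_of_pos x hb
      have := mul_nonpos_of_nonpos_of_nonneg y.le ha
      by_contra hz
      have := mul_nonneg hs.le (not_lt.mp hz)
      linarith
  have c1 := cv s h1 h2
  have c2 := cv t h3 h4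
  obtain ⟨u0, v0, u1, v1, u2, v2, u3, v3⟩ := H
  fin_cases s <;> fin_cases t
  · exact hst rfl
  · exact adj 0 h2 h3
  · exact lt_asymm (c1.1 v0 v1) (c2.2.1 v2 v3)
  · exact adj 3 h4 h1
  · exact adj 0 h4 h1
  · exact hst rfl
  · exact adj 1 h2 h3
  · exact lt_asymm (c1.2.2.2 u1 u2) (c2.2.2.1 u3 u0)
  · exact lt_asymm (c2.1 v0 v1) (c1.2.1 v2 v3)
  · exact adj 1 h4 h1
  · exact hst rfl
  · exact adj 2 h2 h3
  · exact adj 3 h2 h3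
  · exact lt_asymm (c2.2.2.2 u1 u2) (c1.2.2.1 u3 u0)
  · exact adj 2 h4 h1
  · exact hst rfl

lemma Quad.edge {u v : Pt → ℝ} {h : Fin 4 → Pt} (H : Quad u v h) (hu : Aff u) (hv : Aff v)
    (s : Fin 4) (q z : Pt) (h1 : 0 ≤ crs u v (h s) q) (h2 : 0 ≤ crs u v q (h (s + 1)))
    (hz : z ∈ openSegment ℝ q (h s)) :
    0 ≤ crs u v (h s) z ∧ 0 < crs u v z (h (s + 1)) := by
  obtain ⟨a, b, ha, hb, hab, rfl⟩ := hz
  have hs := H.step s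
  have e1 : crs u v (h s) (a • q + b • h s) = a * crs u v (h s) q := by
    unfold crs; rw [hu a b _ _ hab, hv a b _ _ hab]; ring
  have e2 : crs u v (a • q + b • h s) (h (s + 1)) =
      a * crs u v q (h (s + 1)) + b * crs u v (h s) (h (s + 1)) := by
    unfold crs; rw [hu a b _ _ hab, hv a b _ _ hab]; ring
  rw [e1, e2]
  exact ⟨mul_nonneg ha.le h1, by have := mul_nonneg ha.le h2; have := mul_pos hb hs; linarith⟩

lemma exists_generic (e σ t : ℝ) (S : Finset Pt) (hinj : Set.InjOn (ph e) S) (M m : ℝ)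
    (hMm : M < m) : ∃ x0, M < x0 ∧ x0 < m ∧ ∀ p ∈ S, ∀ q ∈ S, p ≠ q → vv e σ t p ≠ 0 →
      vv e σ t q ≠ 0 → crs (fun p => ph e p - x0) (vv e σ t) p q ≠ 0 := by
  classical
  let bad : Finset ℝ := (S ×ˢ S).image (fun x =>
    (ph e x.2 * vv e σ t x.1 - ph e x.1 * vv e σ t x.2) / (vv e σ t x.1 - vv e σ t x.2))
  obtain ⟨x0, hx0, hbad⟩ := ((Set.Ioo_infinite hMm).sdiff bad.finite_toSet).nonempty
  refine ⟨x0, hx0.1, hx0.2, ?_⟩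
  intro p hp q hq hpq hvp hvq h0
  unfold crs at h0
  by_cases he : vv e σ t p = vv e σ t q
  · rw [he] at h0
    apply hpq
    apply hinj hp hq
    apply mul_right_cancel₀ hvq
    linear_combination h0
  · apply hbad
    rw [Finset.mem_coe, Finset.mem_image]
    refine ⟨(p, q), Finset.mem_product.mpr ⟨hp, hq⟩, ?_⟩
    simp only
    rw [div_eq_iff (sub_ne_zero.mpr he)]
    linear_combination -h0

/-- The combined parent functions on the whole set. -/
lemma main_par (e : ℝ) (k s d : ℕ) (hk : 1 ≤ k) (hs : 4 * k + 6 ≤ s) (S : Finset Pt)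
    (hgp : GP S) (hinj : Set.InjOn (ph e) S) (hS1 : 4 * k + 6 ≤ S.card)
    (hS2 : S.card ≤ s * 2 ^ d) :
    ∃ (root : Fin k → Pt) (par : Fin k → Pt → Pt) (dep : Fin k → Pt → ℕ),
      (∀ i, root i ∈ S) ∧ (∀ i, ∀ q ∈ S, q ≠ root i → par i q ∈ S) ∧
      (∀ i, ∀ q ∈ S, dep i q ≤ 2 * d + 4) ∧
      (∀ i, ∀ q ∈ S, q ≠ root i → dep i (par i q) < dep i q) ∧
      (∀ i, ∀ q ∈ S, q ≠ root i → ∀ q' ∈ S, q' ≠ root i → q ≠ q' →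
        openSegment ℝ q (par i q) ∩ openSegment ℝ q' (par i q') = ∅) ∧
      (∀ i j, i ≠ j → ∀ q ∈ S, q ≠ root i → ∀ q' ∈ S, q' ≠ root j →
        ¬ (q = q' ∧ par i q = par j q') ∧ ¬ (par i q = q' ∧ par j q' = q)) ∧
      (∀ i p, (S.filter (fun q => q ≠ root i ∧ par i q = p)).card ≤ 3 * s) := by
  classical
  obtain ⟨L, hLS, hLc, hLlt⟩ := exists_left e S hinj (2 * k + 3) (by omega)
  have hS'c := Finset.card_sdiff_of_subset hLS
  obtain ⟨R, hRS, hRc, hRlt⟩ := exists_left e (S \ L)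
    (hinj.mono (by exact_mod_cast Finset.sdiff_subset)) (2 * k + 3) (by omega)
  have hRS' : R ⊆ S := hRS.trans Finset.sdiff_subset
  obtain ⟨σ, t, hL1, hL2, hR1, hR2⟩ := ham_sandwich e L R (fun p hp q hq => hLlt p hp q (hRS hq))
    (k + 2) (k + 2) (by omega) (by omega) (by omega) (by omega)
  obtain ⟨hL3, hL4, hL5⟩ := count_sides e σ t S L hgp hLS _ hL1 hL2
  obtain ⟨hR3, hR4, hR5⟩ := count_sides e σ t S R hgp hRS' _ hR1 hR2
  -- the generic center
  obtain ⟨pM, hpM, hM⟩ := Finset.exists_max_image L (ph e) (by rw [← Finset.card_pos]; omega)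
  obtain ⟨pm, hpm, hm⟩ := Finset.exists_min_image (S \ L) (ph e)
    (by rw [← Finset.card_pos]; omega)
  obtain ⟨x0, hx1, hx2, hgen⟩ := exists_generic e σ t S hinj _ _ (hLlt pM hpM pm hpm)
  set v : Pt → ℝ := vv e σ t with hv
  set u : Pt → ℝ := fun p => ph e p - x0 with hu
  have affv : Aff v := aff_vv e σ t
  have affu : Aff u := by
    intro a b p q hab
    have := aff_ph e a b p q hab
    simp only [hu]
    rw [this]
    linear_combination x0 * hab
  have huL : ∀ p ∈ L, u p < 0 := by
    intro p hp; have := hM p hp; simp only [hu]; linarith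
  have huR : ∀ p ∈ S, p ∉ L → 0 < u p := by
    intro p hp hpL
    have := hm p (Finset.mem_sdiff.mpr ⟨hp, hpL⟩); simp only [hu]; linarith
  have huRR : ∀ p ∈ R, 0 < u p := fun p hp =>
    huR p (hRS' hp) (Finset.mem_sdiff.mp (hRS hp)).2
  have hune : ∀ p ∈ S, u p ≠ 0 := by
    intro p hp
    by_cases hpL : p ∈ L
    · exact (huL p hpL).ne
    · exact (huR p hp hpL).ne'
  -- hubs
  obtain ⟨g0, g0i, g0m⟩ := exists_inj (R.filter (fun p => 0 < v p)) k (by omega)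
  obtain ⟨g1, g1i, g1m⟩ := exists_inj (L.filter (fun p => 0 < v p)) k (by omega)
  obtain ⟨g2, g2i, g2m⟩ := exists_inj (L.filter (fun p => v p < 0)) k (by omega)
  obtain ⟨g3, g3i, g3m⟩ := exists_inj (R.filter (fun p => v p < 0)) k (by omega)
  simp only [Finset.mem_filter] at g0m g1m g2m g3m
  set h : Fin k → Fin 4 → Pt := fun i => ![g0 i, g1 i, g2 i, g3 i] with hh
  have hQ : ∀ i, Quad u v (h i) := fun i =>
    ⟨huRR _ (g0m i).1, (g0m i).2, huL _ (g1m i).1, (g1m i).2, huL _ (g2m i).1, (g2m i).2,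
      huRR _ (g3m i).1, (g3m i).2⟩
  have hG : ∀ i a, h i a ∈ L ∪ R := by
    intro i a
    rw [Finset.mem_union]
    fin_cases a
    · exact Or.inr (g0m i).1
    · exact Or.inl (g1m i).1
    · exact Or.inl (g2m i).1
    · exact Or.inr (g3m i).1
  have hGS : L ∪ R ⊆ S := Finset.union_subset hLS hRS'
  have hhS : ∀ i a, h i a ∈ S := fun i a => hGS (hG i a)
  have hvne : ∀ i a, v (h i a) ≠ 0 := by
    intro i a
    fin_cases a
    · exact (hQ i).v0.ne'
    · exact (hQ i).v1.ne'
    · exact (hQ i).v2.ne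
    · exact (hQ i).v3.ne
  have hhinj : ∀ i j a b, h i a = h j b → a = b ∧ i = j := by
    intro i j a b hab
    obtain ⟨a0, a1, a2, a3, a4, a5, a6, a7⟩ := hQ i
    obtain ⟨b0, b1, b2, b3, b4, b5, b6, b7⟩ := hQ j
    have hab1 := congrArg u hab
    have hab2 := congrArg v hab
    fin_cases a <;> fin_cases b <;> simp only [Fin.mk_one, Fin.zero_eta, Fin.reduceFinMk] at hab hab1 hab2 <;>
      first
      | exact ⟨by trivial, g0i hab⟩
      | exact ⟨by trivial, g1i hab⟩
      | exact ⟨by trivial, g2i hab⟩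
      | exact ⟨by trivial, g3i hab⟩
      | (exfalso; linarith)
  -- the recursion on the remaining points
  set A : Finset Pt := S \ (L ∪ R) with hA
  have hAS : A ⊆ S := Finset.sdiff_subset
  have hAlt : ∀ p ∈ L ∪ R, ∀ q ∈ A, ph e p < ph e q := by
    intro p hp q hq
    simp only [hA, Finset.mem_sdiff, Finset.mem_union, not_or] at hq hp
    rcases hp with hp | hp
    · exact hLlt p hp q (Finset.mem_sdiff.mpr ⟨hq.1, hq.2.1⟩)
    · exact hRlt p hp q (Finset.mem_sdiff.mpr ⟨Finset.mem_sdiff.mpr ⟨hq.1, hq.2.1⟩, hq.2.2⟩)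
  have hhA : ∀ i a, h i a ∉ A := by
    intro i a ha
    exact (Finset.mem_sdiff.mp ha).2 (hG i a)
  obtain ⟨parR, N, depR, hR⟩ := rec_exists e k s hk (by omega) d A (hgp.mono hAS)
    (hinj.mono (by exact_mod_cast hAS)) ((Finset.card_le_card hAS).trans hS2)
  set dr : Fin k → Pt → ℕ := fun i q => if q = h i 0 then 0 else if q = h i 1 then 1
    else if q = h i 2 then 2 else if q = h i 3 then 3 else 4 with hdr
  have dr0 : ∀ i, dr i (h i 0) = 0 := by intro i; simp [hdr]
  have hne : ∀ i a b, a ≠ b → h i a ≠ h i b := fun i a b hab he => hab (hhinj i i a b he).1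
  have dr1 : ∀ i, dr i (h i 1) = 1 := by
    intro i; simp only [hdr]; rw [if_neg (hne i 1 0 (by decide)), if_pos trivial]
  have dr2 : ∀ i, dr i (h i 2) = 2 := by
    intro i; simp only [hdr]
    rw [if_neg (hne i 2 0 (by decide)), if_neg (hne i 2 1 (by decide)), if_pos trivial]
  have dr3 : ∀ i, dr i (h i 3) = 3 := by
    intro i; simp only [hdr]
    rw [if_neg (hne i 3 0 (by decide)), if_neg (hne i 3 1 (by decide)),
      if_neg (hne i 3 2 (by decide)), if_pos trivial]
  have drh : ∀ i a, dr i (h i a) ≤ 3 := by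
    intro i a
    fin_cases a
    · exact (dr0 i).le.trans (by omega)
    · exact (dr1 i).le.trans (by omega)
    · exact (dr2 i).le.trans (by omega)
    · exact (dr3 i).le
  have dr4 : ∀ i q, (∀ a, q ≠ h i a) → dr i q = 4 := by
    intro i q hq
    simp only [hdr]
    rw [if_neg (hq 0), if_neg (hq 1), if_neg (hq 2), if_neg (hq 3)]
  have drle : ∀ i q, dr i q ≤ 4 := by
    intro i q
    simp only [hdr]
    split_ifs <;> omega
  have hchain : ∀ i (a : Fin 4), 0 ≤ crs u v (h i a) (h i (a + 1)) ∧
      0 ≤ crs u v (h i (a + 1)) (h i (a + 1)) := by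
    intro i a
    refine ⟨((hQ i).step a).le, ?_⟩
    unfold crs
    apply le_of_eq; ring
  have hpar : ∀ i q, ∃ p, ((q ∈ A ∧ q ∉ N i) → p = parR i q) ∧
      (¬ (q ∈ A ∧ q ∉ N i) → q ∈ S → q ≠ h i 0 → ∃ a : Fin 4, p = h i a ∧ q ≠ p ∧
        0 ≤ crs u v (h i a) q ∧ 0 ≤ crs u v q (h i (a + 1)) ∧ dr i p < dr i q) := by
    intro i q
    by_cases hc : q ∈ A ∧ q ∉ N i
    · exact ⟨parR i q, fun _ => rfl, fun h => absurd hc h⟩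
    · by_cases hq1 : q = h i 1
      · subst hq1
        refine ⟨h i 0, fun h => absurd h hc, fun _ _ _ => ⟨0, rfl, hne i 1 0 (by decide),
          (hchain i 0).1, (hchain i 0).2, ?_⟩⟩
        rw [dr0, dr1]; omega
      by_cases hq2 : q = h i 2
      · subst hq2
        refine ⟨h i 1, fun h => absurd h hc, fun _ _ _ => ⟨1, rfl, hne i 2 1 (by decide),
          (hchain i 1).1, (hchain i 1).2, ?_⟩⟩
        rw [dr1, dr2]; omega
      by_cases hq3 : q = h i 3
      · subst hq3
        refine ⟨h i 2, fun h => absurd h hc, fun _ _ _ => ⟨2, rfl, hne i 3 2 (by decide),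
          (hchain i 2).1, (hchain i 2).2, ?_⟩⟩
        rw [dr2, dr3]; omega
      by_cases hqS : q ∈ S
      · by_cases hq0 : q = h i 0
        · exact ⟨q, fun h => absurd h hc, fun _ _ h => absurd hq0 h⟩
        · have hall : ∀ a, q ≠ h i a := by
            intro a
            fin_cases a
            · exact hq0
            · exact hq1
            · exact hq2
            · exact hq3
          obtain ⟨a, ha1, ha2⟩ := (hQ i).cover q (hune q hqS)
          refine ⟨h i a, fun h => absurd h hc, fun _ _ _ => ⟨a, rfl, hall a, ha1, ha2.le, ?_⟩⟩
          rw [dr4 i q hall]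
          have := drh i a
          omega
      · exact ⟨q, fun h => absurd h hc, fun _ h => absurd h hqS⟩
  choose par hpar1 hpar2 using hpar
  -- basic facts about root type edges: the child is left of everything in the recursion
  have hleft : ∀ i q q', ¬ (q ∈ A ∧ q ∉ N i) → q ∈ S → q' ∈ A → q' ∉ N i →
      ph e q ≤ ph e (parR i q') := by
    intro i q q' h1 h2 h3 h4
    by_cases hqA : q ∈ A
    · have hqN : q ∈ N i := by
        by_contra hn; exact h1 ⟨hqA, hn⟩
      exact hR.head i q hqN q' h3 h4
    · have hqG : q ∈ L ∪ R := by
        by_contra hn; exact hqA (Finset.mem_sdiff.mpr ⟨h2, hn⟩)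
      exact (hAlt q hqG _ (hR.par_mem i q' h3 h4)).le
  have pl12 : ∀ i q q', ¬ (q ∈ A ∧ q ∉ N i) → q ∈ S → q ≠ h i 0 → (q' ∈ A ∧ q' ∉ N i) →
      openSegment ℝ q (par i q) ∩ openSegment ℝ q' (par i q') = ∅ := by
    intro i q q' h1 h2 h3 h4
    rw [hpar1 i q' h4]
    obtain ⟨a, ha, _⟩ := hpar2 i q h1 h2 h3
    have e1 := hleft i q q' h1 h2 h4.1 h4.2
    have e2 := hR.par_lt i q' h4.1 h4.2
    have e3 := hAlt _ (hG i a) _ (hR.par_mem i q' h4.1 h4.2)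
    rw [← ha] at e3
    exact disj_sep (aff_ph e) (ph e (parR i q')) e3 e1 le_rfl e2.le
  refine ⟨fun i => h i 0, par, fun i q => if q ∈ A then depR i q + 4 else dr i q,
    fun i => hhS i 0, ?_, ?_, ?_, ?_, ?_, ?_⟩
  · intro i q hq hq0
    by_cases hc : q ∈ A ∧ q ∉ N i
    · rw [hpar1 i q hc]; exact hAS (hR.par_mem i q hc.1 hc.2)
    · obtain ⟨a, ha, _⟩ := hpar2 i q hc hq hq0
      rw [ha]; exact hhS i a
  · intro i q hq
    beta_reduce
    split_ifs with hqA
    · have := hR.dep_le i q hqA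
      omega
    · have := drle i q
      omega
  · intro i q hq hq0
    beta_reduce
    by_cases hc : q ∈ A ∧ q ∉ N i
    · rw [hpar1 i q hc, if_pos hc.1, if_pos (hR.par_mem i q hc.1 hc.2)]
      have := hR.dep_lt i q hc.1 hc.2
      omega
    · obtain ⟨a, ha, _, _, _, hd⟩ := hpar2 i q hc hq hq0
      have hnA : par i q ∉ A := by rw [ha]; exact hhA i a
      rw [if_neg hnA]
      split_ifs with hqA
      · have := drle i q
        omega
      · exact hd
  · intro i q hq hq0 q' hq' hq0' hqq
    by_cases hc : q ∈ A ∧ q ∉ N i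
    · by_cases hc' : q' ∈ A ∧ q' ∉ N i
      · rw [hpar1 i q hc, hpar1 i q' hc']
        exact hR.plane i q hc.1 hc.2 q' hc'.1 hc'.2 hqq
      · rw [Set.inter_comm]
        exact pl12 i q' q hc' hq' hq0' hc
    · by_cases hc' : q' ∈ A ∧ q' ∉ N i
      · exact pl12 i q q' hc hq hq0 hc'
      · obtain ⟨a, ha, ha0, ha1, ha2, _⟩ := hpar2 i q hc hq hq0
        obtain ⟨b, hb, hb0, hb1, hb2, _⟩ := hpar2 i q' hc' hq' hq0'
        by_cases hab : a = b
        · subst hab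
          rw [hb] at hb0 ⊢
          rw [ha] at ha0 ⊢
          exact disj_share (hgp _ (hhS i a) q hq q' hq' ha0.symm hb0.symm hqq)
        · rw [ha, hb, Set.eq_empty_iff_forall_notMem]
          rintro z ⟨hz1, hz2⟩
          obtain ⟨c1, c2⟩ := (hQ i).edge affu affv a q z ha1 ha2 hz1
          obtain ⟨c3, c4⟩ := (hQ i).edge affu affv b q' z hb1 hb2 hz2
          exact (hQ i).cone_disj z a b hab c1 c2 c3 c4
  · intro i j hij q hq hq0 q' hq' hq0'
    by_cases hc : q ∈ A ∧ q ∉ N i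
    · have hp := hpar1 i q hc
      have hpA := hR.par_mem i q hc.1 hc.2
      rw [← hp] at hpA
      have hplt := hR.par_lt i q hc.1 hc.2
      rw [← hp] at hplt
      by_cases hc' : q' ∈ A ∧ q' ∉ N j
      · have hp' := hpar1 j q' hc'
        have hplt' := hR.par_lt j q' hc'.1 hc'.2
        rw [← hp'] at hplt'
        refine ⟨?_, ?_⟩
        · rintro ⟨rfl, h2⟩
          rw [hp, hp'] at h2
          exact hij (hR.disj i j q hc.1 hc.2 hc'.2 h2)
        · rintro ⟨h1, h2⟩
          rw [h1] at hplt
          rw [h2] at hplt'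
          exact lt_asymm hplt hplt'
      · obtain ⟨b, hb, _⟩ := hpar2 j q' hc' hq' hq0'
        refine ⟨?_, ?_⟩
        · rintro ⟨h1, h2⟩
          rw [h2, hb] at hpA
          exact hhA j b hpA
        · rintro ⟨h1, h2⟩
          rw [← h2, hb] at hc
          exact hhA j b hc.1
    · obtain ⟨a, ha, ha0, ha1, ha2, _⟩ := hpar2 i q hc hq hq0
      by_cases hc' : q' ∈ A ∧ q' ∉ N j
      · have hp' := hpar1 j q' hc'
        have hpA' := hR.par_mem j q' hc'.1 hc'.2
        rw [← hp'] at hpA'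
        refine ⟨?_, ?_⟩
        · rintro ⟨h1, h2⟩
          rw [← h2, ha] at hpA'
          exact hhA i a hpA'
        · rintro ⟨h1, h2⟩
          rw [← h1, ha] at hc'
          exact hhA i a hc'.1
      · obtain ⟨b, hb, hb0, hb1, hb2, _⟩ := hpar2 j q' hc' hq' hq0'
        refine ⟨?_, ?_⟩
        · rintro ⟨h1, h2⟩
          rw [ha, hb] at h2
          exact hij (hhinj i j a b h2).2
        · rintro ⟨h1, h2⟩
          rw [ha] at h1
          rw [hb] at h2
          rw [← h2] at ha1
          rw [← h1, crs_swap] at hb1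
          have hz : crs u v (h i a) (h j b) = 0 := by linarith
          refine hgen _ (hhS i a) _ (hhS j b) ?_ (hvne i a) (hvne j b) hz
          intro he
          exact hij (hhinj i j a b he).2
  · intro i p
    by_cases hp : p ∈ A
    · refine le_trans (Finset.card_le_card ?_) (hR.deg i p)
      intro q hq
      simp only [Finset.mem_filter] at hq ⊢
      obtain ⟨hqS, hq0, hqp⟩ := hq
      by_cases hc : q ∈ A ∧ q ∉ N i
      · exact ⟨hc.1, hc.2, by rw [← hpar1 i q hc]; exact hqp⟩
      · obtain ⟨a, ha, _⟩ := hpar2 i q hc hqS hq0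
        rw [← hqp, ha] at hp
        exact absurd hp (hhA i a)
    · have hsub : S.filter (fun q => q ≠ h i 0 ∧ par i q = p) ⊆ (L ∪ R) ∪ N i := by
        intro q hq
        simp only [Finset.mem_filter] at hq
        obtain ⟨hqS, hq0, hqp⟩ := hq
        by_contra hn
        rw [Finset.mem_union, not_or] at hn
        have hqA : q ∈ A := Finset.mem_sdiff.mpr ⟨hqS, hn.1⟩
        apply hp
        rw [← hqp, hpar1 i q ⟨hqA, hn.2⟩]
        exact hR.par_mem i q hqA hn.2
      have c1 := Finset.card_le_card hsub
      have c2 := Finset.card_union_le (L ∪ R) (N i)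
      have c3 := Finset.card_union_le L R
      have c4 := hR.Ncard i
      exact c1.trans (by omega)

end rootpart

section numeric

lemma exists_depth (n k : ℕ) (hk : 1 ≤ k) (h : (k : ℝ) ≤ Real.sqrt ((n : ℝ) / 12)) :
    12 * k ^ 2 ≤ n ∧ ∃ d : ℕ, n ≤ 12 * k ^ 2 * 2 ^ d ∧
      0 ≤ Real.logb 2 ((n : ℝ) / (k : ℝ) ^ 2) ∧
      (d : ℝ) ≤ Real.logb 2 ((n : ℝ) / (k : ℝ) ^ 2) + 1 := by
  have hk0 : (0 : ℝ) < (k : ℝ) := by exact_mod_cast hk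
  have h1 : (k : ℝ) ^ 2 ≤ (n : ℝ) / 12 := (Real.le_sqrt' hk0).mp h
  have h2 : 12 * (k : ℝ) ^ 2 ≤ n := by linarith
  have hk2 : (0 : ℝ) < (k : ℝ) ^ 2 := by positivity
  have h3 : (1 : ℝ) ≤ (n : ℝ) / (k : ℝ) ^ 2 := by
    rw [le_div_iff₀ hk2]; linarith
  have hx : 0 ≤ Real.logb 2 ((n : ℝ) / (k : ℝ) ^ 2) :=
    Real.logb_nonneg (by norm_num) h3
  refine ⟨by exact_mod_cast h2, ⌈Real.logb 2 ((n : ℝ) / (k : ℝ) ^ 2)⌉₊, ?_, hx,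
    (Nat.ceil_lt_add_one hx).le⟩
  set d := ⌈Real.logb 2 ((n : ℝ) / (k : ℝ) ^ 2)⌉₊ with hd
  have h4 : Real.logb 2 ((n : ℝ) / (k : ℝ) ^ 2) ≤ (d : ℝ) := Nat.le_ceil _
  have h5 : (n : ℝ) / (k : ℝ) ^ 2 ≤ 2 ^ d := by
    have := (Real.logb_le_iff_le_rpow (by norm_num) (by linarith)).mp h4
    rwa [Real.rpow_natCast] at this
  rw [div_le_iff₀ hk2] at h5
  have h6 : (n : ℝ) ≤ 12 * (k : ℝ) ^ 2 * 2 ^ d := by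
    have : (0 : ℝ) ≤ 2 ^ d * (k : ℝ) ^ 2 := by positivity
    nlinarith
  exact_mod_cast h6

end numeric

/-- There are absolute constants `c₁, c₂ > 0` such that for every set of
`n` points in general position and every `1 ≤ k ≤ √(n/12)` there exist `k` pairwise
edge-disjoint plane spanning trees in which every vertex has degree at most `c₁·k²`
and whose diameter is at most `c₂·(1 + log₂(n/k²))`. -/
theorem bounded_degree_diameter_trees :
    ∃ c₁ c₂ : ℝ, 0 < c₁ ∧ 0 < c₂ ∧
      ∀ (S : Finset Pt) (n k : ℕ), S.card = n → GenPos S → 1 ≤ k →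
        (k : ℝ) ≤ Real.sqrt ((n : ℝ) / 12) →
        ∃ T : Fin k → SimpleGraph {x // x ∈ S},
          (∀ i, IsPlaneSpanningTree (T i)) ∧
          (∀ i j, i ≠ j → Disjoint (T i).edgeSet (T j).edgeSet) ∧
          (∀ i, ∀ v, (((T i).neighborSet v).ncard : ℝ) ≤ c₁ * (k : ℝ) ^ 2) ∧
          (∀ i, ∀ u v, (((T i).dist u v : ℕ) : ℝ) ≤
            c₂ * (1 + Real.logb 2 ((n : ℝ) / (k : ℝ) ^ 2))) := by
  classical
  refine ⟨37, 12, by norm_num, by norm_num, ?_⟩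
  intro S n k hn hgp hk hkn
  obtain ⟨h12, d, hd, hx, hdx⟩ := exists_depth n k hk hkn
  obtain ⟨e, hinj⟩ := exists_dir S
  have hs : 4 * k + 6 ≤ 12 * k ^ 2 := by nlinarith
  obtain ⟨root, par, dep, hroot, hpar, hdep, hlt, hplane, hdisj, hdeg⟩ :=
    main_par e k (12 * k ^ 2) d hk hs S hgp.gp hinj (by omega) (by omega)
  let rt : Fin k → {x // x ∈ S} := fun i => ⟨root i, hroot i⟩
  let f : Fin k → {x // x ∈ S} → {x // x ∈ S} := fun i q =>
    if hq : (q : Pt) = root i then q else ⟨par i q, hpar i q q.2 hq⟩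
  have hne : ∀ i (q : {x // x ∈ S}), q ≠ rt i → (q : Pt) ≠ root i := by
    intro i q hq h
    exact hq (Subtype.ext h)
  have hf : ∀ i (q : {x // x ∈ S}), q ≠ rt i → (f i q : Pt) = par i q := by
    intro i q hq
    simp only [f]
    rw [dif_neg (hne i q hq)]
  have hdec : ∀ i (q : {x // x ∈ S}), q ≠ rt i → dep i (f i q) < dep i q := by
    intro i q hq
    rw [hf i q hq]
    exact hlt i q q.2 (hne i q hq)
  have hpl : ∀ i (q q' : {x // x ∈ S}), q ≠ rt i → q' ≠ rt i → q ≠ q' →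
      openSegment ℝ (q : Pt) (f i q) ∩ openSegment ℝ (q' : Pt) (f i q') = ∅ := by
    intro i q q' h1 h2 h3
    rw [hf i q h1, hf i q' h2]
    exact hplane i q q.2 (hne i q h1) q' q'.2 (hne i q' h2) (fun h => h3 (Subtype.ext h))
  have hdj : ∀ i j, i ≠ j → ∀ q q' : {x // x ∈ S}, q ≠ rt i → q' ≠ rt j →
      s(q, f i q) ≠ s(q', f j q') := by
    intro i j hij q q' h1 h2 h3
    have := hdisj i j hij q q.2 (hne i q h1) q' q'.2 (hne j q' h2)
    rw [← hf i q h1, ← hf j q' h2] at this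
    rcases Sym2.eq_iff.mp h3 with ⟨h4, h5⟩ | ⟨h4, h5⟩
    · exact this.1 ⟨congrArg _ h4, congrArg _ h5⟩
    · exact this.2 ⟨congrArg _ h5, (congrArg _ h4).symm⟩
  have hadj : ∀ i a b, (parGraph (rt i) (f i)).Adj a b →
      ∃ q, q ≠ rt i ∧ s(a, b) = s(q, f i q) ∧
        openSegment ℝ (a : Pt) (b : Pt) = openSegment ℝ (q : Pt) (f i q) := by
    intro i a b hab
    rcases ((parGraph_adj _ _ _ _).mp hab).2 with ⟨h1, h2⟩ | ⟨h1, h2⟩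
    · exact ⟨a, h1, by rw [h2], by rw [h2]⟩
    · exact ⟨b, h1, by rw [h2]; exact Sym2.eq_swap, by rw [h2]; exact openSegment_symm ℝ _ _⟩
  refine ⟨fun i => parGraph (rt i) (f i), ?_, ?_, ?_, ?_⟩
  · intro i
    refine ⟨parGraph_tree (rt i) (f i) (fun q => dep i q) (hdec i), ?_⟩
    intro a b c d' hab hcd hne'
    obtain ⟨q, hq, e1, e2⟩ := hadj i a b hab
    obtain ⟨q', hq', e3, e4⟩ := hadj i c d' hcd
    rw [e2, e4]
    refine hpl i q q' hq hq' ?_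
    rintro rfl
    exact hne' (e1.trans e3.symm)
  · intro i j hij
    rw [Set.disjoint_left]
    intro x hxi hxj
    induction x using Sym2.ind with
    | _ a b =>
      rw [SimpleGraph.mem_edgeSet] at hxi hxj
      obtain ⟨q, hq, e1, -⟩ := hadj i a b hxi
      obtain ⟨q', hq', e3, -⟩ := hadj j a b hxj
      exact hdj i j hij q q' hq hq' (e1.symm.trans e3)
  · intro i v
    have hsub : Set.image Subtype.val ((parGraph (rt i) (f i)).neighborSet v) ⊆
        ((insert (f i v : Pt) (S.filter (fun q => q ≠ root i ∧ par i q = v)) : Finset Pt) :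
          Set Pt) := by
      rintro _ ⟨w, hw, rfl⟩
      rw [SimpleGraph.mem_neighborSet] at hw
      rw [Finset.mem_coe, Finset.mem_insert, Finset.mem_filter]
      rcases ((parGraph_adj _ _ _ _).mp hw).2 with ⟨h1, h2⟩ | ⟨h1, h2⟩
      · left; rw [h2]
      · right
        exact ⟨w.2, hne i w h1, by rw [← hf i w h1, h2]⟩
    have h1 := Set.ncard_le_ncard hsub (Finset.finite_toSet _)
    rw [Set.ncard_image_of_injective _ Subtype.val_injective, Set.ncard_coe_finset] at h1
    have h2 := Finset.card_insert_le (f i v : Pt)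
      (S.filter (fun q => q ≠ root i ∧ par i q = v))
    have h3 := hdeg i v
    have h4 : 1 ≤ k ^ 2 := Nat.one_le_pow _ _ hk
    have h5 : ((parGraph (rt i) (f i)).neighborSet v).ncard ≤ 37 * k ^ 2 := by omega
    exact_mod_cast h5
  · intro i u v
    have h1 := parGraph_dist (rt i) (f i) (fun q => dep i q) (hdec i) u v
    have h2 := hdep i u u.2
    have h3 := hdep i v v.2
    have h4 : (parGraph (rt i) (f i)).dist u v ≤ 4 * d + 8 := by
      omega
    have h5 : (((parGraph (rt i) (f i)).dist u v : ℕ) : ℝ) ≤ 4 * (d : ℝ) + 8 := by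
      exact_mod_cast h4
    show (((parGraph (rt i) (f i)).dist u v : ℕ) : ℝ) ≤ _
    linarith
end
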